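/- Let G be a vertex-minimal triangle-free, fork-free graph with chromatic number at least 4, let C be a good 5-cycle in G, and let u, v be two nonadjacent vertices of C. Then u and v have exactly one common neighbor (namely their common neighbor on C). -/

import Mathlib

open SimpleGraph

/-- The fork: `K_{1,4}` with two edges subdivided. Vertex 0 is the center,
adjacent to leaves 1, 2 and to 3, 5; paths 0-3-4 and 0-5-6. -/
def fork : SimpleGraph (Fin 7) :=
  SimpleGraph.fromEdgeSet {s(0, 1), s(0, 2), s(0, 3), s(0, 5), s(3, 4), s(5, 6)}

/-- A graph is fork-free if it has no induced subgraph isomorphic to the fork. -/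
def ForkFree {V : Type} (G : SimpleGraph V) : Prop :=
  IsEmpty (fork ↪g G)

/-- `G` is a vertex-minimal triangle-free, fork-free graph with chromatic
number at least 4: every smaller triangle-free fork-free graph is 3-colorable. -/
def MinCex {V : Type} [Fintype V] (G : SimpleGraph V) : Prop :=
  G.CliqueFree 3 ∧ ForkFree G ∧ 4 ≤ G.chromaticNumber ∧
    ∀ (W : Type) [Fintype W] (H : SimpleGraph W),
      Fintype.card W < Fintype.card V → H.CliqueFree 3 → ForkFree H →
        H.chromaticNumber ≤ 3

/-- `c` describes a 5-cycle in `G`. -/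
def IsC5 {V : Type} (G : SimpleGraph V) (c : Fin 5 → V) : Prop :=
  Function.Injective c ∧ ∀ i : Fin 5, G.Adj (c i) (c (i + 1))

/-- Distance from a vertex `u` to the 5-cycle `c`. -/
noncomputable def distC {V : Type} (G : SimpleGraph V) (c : Fin 5 → V) (u : V) : ℕ :=
  Finset.univ.inf' Finset.univ_nonempty fun i => G.dist u (c i)

/-- A good 5-cycle: one minimizing the number of vertices at distance at least 2. -/
def GoodC5 {V : Type} (G : SimpleGraph V) (c : Fin 5 → V) : Prop :=
  IsC5 G c ∧ ∀ d : Fin 5 → V, IsC5 G d →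
    {u : V | 2 ≤ distC G c u}.ncard ≤ {u : V | 2 ≤ distC G d u}.ncard


/-! ## A small certificate checker

A finite graph is coded by the list of its adjacency rows (bit masks).  The checker verifies that
certain small graphs cannot occur as induced subgraphs of a minimal counterexample. -/

namespace ForkCert

def isZ (n : Nat) : Bool := Nat.beq n 0

/-- Evaluate a natural number before passing it on (for kernel evaluation only). -/
def force {α : Type} (n : Nat) (f : Nat → α) : α :=
  Nat.rec (f 0) (fun k _ => f (Nat.succ k)) n

def nth (l : List Nat) : Nat → Nat :=
  List.rec (fun _ => 0) (fun x _ ih k => Nat.rec x (fun j _ => ih j) k) l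

def nthL (l : List (List Nat)) : Nat → List Nat :=
  List.rec (fun _ => [1]) (fun x _ ih k => Nat.rec x (fun j _ => ih j) k) l

def pw (k : Nat) : Nat := Nat.shiftLeft 1 k

/-- bit test -/
def tb (m k : Nat) : Bool := Nat.beq (Nat.land (Nat.shiftRight m k) 1) 1

/-- the cube `(P, Q)` contains the mask `m`: `P ⊆ m` and `Q ∩ m = ∅` -/
def hit (x : Nat × Nat) (m : Nat) : Bool :=
  Nat.beq (Nat.land x.1 m) x.1 && isZ (Nat.land x.2 m)

def filt (b b2 m : Nat) (v : Bool) (l : List (Nat × Nat)) :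
    List (Nat × Nat) → Option (List (Nat × Nat)) :=
  List.rec (fun acc => some acc) (fun x _ ih acc =>
    bif isZ (Nat.land (bif v then x.2 else x.1) b) then
      (bif (Nat.blt x.1 b2 && (Nat.blt x.2 b2 && hit x m)) then none else ih (x :: acc))
    else ih acc) l

/-- every triangle-free mask lies in one of the cubes -/
def dead (rows : List Nat) : Nat → Nat → List (Nat × Nat) → Bool :=
  List.rec (fun _ _ _ => false) (fun r _ ih b m cs =>
    force (Nat.add b b) fun b2 =>
    (Option.rec true (fun c => ih b2 m c) (filt b b2 m false cs [])) &&
    (!isZ (Nat.land r m) || force (Nat.add m b) fun m2 =>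
      Option.rec true (fun c => ih b2 m2 c) (filt b b2 m2 true cs []))) rows

/-- base-32 digits, as many as the length of the list -/
def digs (l : List Nat) : Nat → List Nat :=
  List.rec (fun _ => []) (fun _ _ ih code =>
    force (Nat.land code 31) fun d => force (Nat.shiftRight code 5) fun c => d :: ih c) l

def pows (l : List Nat) : List Nat :=
  List.rec [] (fun s _ ih => force (pw s) fun p => p :: ih) l

/-- union of pairwise disjoint masks -/
def dis (l : List Nat) : Nat → Option Nat :=
  List.rec (fun acc => some acc) (fun p _ ih acc =>
    bif isZ (Nat.land p acc) then force (Nat.lor acc p) fun a => ih a else none) l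

/-- image of the row `row` under the map given by `ps` -/
def img (row : Nat) (ps : List Nat) : Nat :=
  List.rec (fun _ => 0) (fun p _ ih row =>
    force (Nat.shiftRight row 1) fun r =>
    bif isZ (Nat.land row 1) then ih r else Nat.lor p (ih r)) ps row

/-- Check the rows of a pattern against a host with new vertices; collect the cube. -/
def rowsChk (g NA : List Nat) (n full Xo Xn : Nat) (ps : List Nat) (pg : List Nat) :
    List Nat → Nat → Nat → Option (Nat × Nat) :=
  List.rec (fun _ P Q => some (P, Q)) (fun r _ ih ss P Q =>
    List.rec none (fun s st _ =>
      force (img r ps) fun I =>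
      bif Nat.blt s n then
        (bif Nat.beq (Nat.land (nth g s) Xo) (Nat.land I full) then ih st P Q else none)
      else
        (bif Nat.blt (Nat.sub s n) NA.length &&
            Nat.beq (Nat.land (nth NA (Nat.sub s n)) Xn) (Nat.shiftRight I n) then
          force (Nat.lor P (Nat.shiftLeft (Nat.land I full) (Nat.mul 16 (Nat.sub s n)))) fun P2 =>
          force (Nat.lor Q (Nat.shiftLeft (Nat.xor Xo (Nat.land I full))
            (Nat.mul 16 (Nat.sub s n)))) fun Q2 =>
          ih st P2 Q2
        else none)) ss) pg

def clauseAux (g NA : List Nat) (n full : Nat) (pg ss : List Nat) : Option (Nat × Nat) :=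
  match dis (pows ss) 0 with
  | none => none
  | some X => force (Nat.land X full) fun Xo => force (Nat.shiftRight X n) fun Xn =>
      rowsChk g NA n full Xo Xn (pows ss) pg ss 0 0

def clause (prev : List (List Nat)) (g NA : List Nat) (n full code : Nat) : Option (Nat × Nat) :=
  clauseAux g NA n full (nthL prev (Nat.land code 255))
    (digs (nthL prev (Nat.land code 255)) (Nat.shiftRight code 8))

def cubes (prev : List (List Nat)) (g NA : List Nat) (n full : Nat) :
    List Nat → List (Nat × Nat) → List (Nat × Nat)
  | [], acc => acc
  | c :: t, acc =>
    match clause prev g NA n full c with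
    | none => cubes prev g NA n full t acc
    | some x => cubes prev g NA n full t (x :: acc)

/-- indices `0, …, n-1` with a Boolean test -/
def allLt (n : Nat) (f : Nat → Bool) : Bool :=
  Nat.rec true (fun k ih => f k && ih) n

def symChk (g : List Nat) : Bool :=
  allLt g.length fun i => allLt g.length fun j => tb (nth g i) j == tb (nth g j) i

def addR : List Nat → List (Nat × Nat) → List (Nat × Nat)
  | [], acc => acc
  | r :: t, acc => (r, 0) :: addR t acc

def tryC (gs : Nat) (R : List Nat) (φ ψ : Nat) : Bool :=
  isZ (Nat.land gs (Nat.lor φ ψ)) && R.all fun r => !isZ (Nat.land r φ)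

/-- list colouring of the deleted set -/
def okS (g : List Nat) (φ0 φ1 φ2 : Nat) :
    List (Nat × Nat × List Nat) → Nat → Nat → Nat → Bool
  | [], _, _, _ => true
  | e :: t, ψ0, ψ1, ψ2 =>
    Nat.beq (Nat.land (Nat.lor φ0 (Nat.lor φ1 φ2)) e.2.1) e.2.1 &&
    ((tryC (nth g e.1) e.2.2 φ0 ψ0 && okS g φ0 φ1 φ2 t (Nat.lor ψ0 (pw e.1)) ψ1 ψ2) ||
     ((tryC (nth g e.1) e.2.2 φ1 ψ1 && okS g φ0 φ1 φ2 t ψ0 (Nat.lor ψ1 (pw e.1)) ψ2) ||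
      (tryC (nth g e.1) e.2.2 φ2 ψ2 && okS g φ0 φ1 φ2 t ψ0 ψ1 (Nat.lor ψ2 (pw e.1)))))

/-- all partial colourings -/
def col (g : List Nat) (S : List (Nat × Nat × List Nat)) :
    List Nat → Nat → Nat → Nat → Bool
  | [], φ0, φ1, φ2 => okS g φ0 φ1 φ2 S 0 0 0
  | t :: T, φ0, φ1, φ2 =>
    okS g φ0 φ1 φ2 S 0 0 0 ||
    ((!isZ (Nat.land (nth g t) φ0) || force (Nat.lor φ0 (pw t)) fun φ => col g S T φ φ1 φ2) &&
     ((!isZ (Nat.land (nth g t) φ1) || force (Nat.lor φ1 (pw t)) fun φ => col g S T φ0 φ φ2) &&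
      (!isZ (Nat.land (nth g t) φ2) || force (Nat.lor φ2 (pw t)) fun φ => col g S T φ0 φ1 φ)))

def maskS : List (Nat × Nat × List Nat) → Nat
  | [] => 0
  | e :: t => Nat.lor (pw e.1) (maskS t)

def inT (n Sm t : Nat) : Bool := Nat.blt t n && !tb Sm t

def critS (g : List Nat) (n Sm : Nat) (cs : List (Nat × Nat)) (e : Nat × Nat × List Nat) : Bool :=
  Nat.blt e.1 n &&
  (dead g 1 0 ((0, pw e.1) :: addR e.2.2 cs) &&
   allLt n fun w => !tb (nth g e.1) w || (tb Sm w || (tb e.2.1 w ||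
      e.2.2.any fun r => Nat.beq (Nat.land r (nth g w)) r)))

def critChk (g : List Nat) (cs : List (Nat × Nat)) (S : List (Nat × Nat × List Nat))
    (a b : Nat) (T : List Nat) : Bool :=
  force g.length fun n => force (maskS S) fun Sm =>
  !S.isEmpty && (S.all (critS g n Sm cs) && (T.all (inT n Sm) && (inT n Sm a && (inT n Sm b &&
    (bif Nat.beq a b then col g S T (pw a) 0 0
     else tb (nth g a) b && col g S T (pw a) (pw b) 0)))))

def sel3 (k h0 h1 h2 : Nat) : Nat :=
  match k with
  | 0 => h0
  | 1 => h1
  | _ => h2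

def anyHit (cs : List (Nat × Nat)) (M : Nat) : Bool := cs.any fun x => hit x M

def pd (c2 : List (Nat × Nat)) (m1 m2 : Nat) : Bool :=
  !isZ (Nat.land m1 m2) ||
  (anyHit c2 (Nat.lor m1 (Nat.shiftLeft m2 16)) || anyHit c2 (Nat.lor m2 (Nat.shiftLeft m1 16)))

def td (c3 : List (Nat × Nat)) (m1 m2 m3 : Nat) : Bool :=
  anyHit c3 (Nat.lor m1 (Nat.lor (Nat.shiftLeft m2 16) (Nat.shiftLeft m3 32)))

def addF (full : Nat) : List (Nat × Nat × Nat) → List (Nat × Nat) → List (Nat × Nat)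
  | [], acc => acc
  | e :: t, acc => force (Nat.xor full e.1) fun q => (e.1, q) :: addF full t acc

def plain (e : Nat × Nat × Nat) : Bool := Nat.beq e.2.1 e.2.2

def pairChk (c2 : List (Nat × Nat)) (x y : Nat × Nat × Nat) : Bool :=
  bif plain x then
    !plain y || (!Nat.beq x.2.1 y.2.1 || pd c2 x.1 y.1)
  else
    plain y ||
      ((!Nat.beq x.2.1 y.2.1 && (!Nat.beq x.2.1 y.2.2 &&
        (!Nat.beq x.2.2 y.2.1 && !Nat.beq x.2.2 y.2.2))) || pd c2 x.1 y.1)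

def triChk (c2 c3 : List (Nat × Nat)) (f : List (Nat × Nat × Nat)) (u : Nat × Nat × Nat) : Bool :=
  plain u || f.all fun p => !(plain p && Nat.beq p.2.1 u.2.1) || (pd c2 u.1 p.1 ||
    f.all fun q => !(plain q && Nat.beq q.2.1 u.2.2) || (pd c2 u.1 q.1 || td c3 u.1 p.1 q.1))

def entChk (full h0 h1 h2 : Nat) (c2 : List (Nat × Nat)) (x : Nat × Nat × Nat) : Bool :=
  Nat.ble x.1 full && (Nat.blt x.2.1 3 && (Nat.blt x.2.2 3 &&
    (isZ (Nat.land x.1 (sel3 x.2.1 h0 h1 h2)) && (isZ (Nat.land x.1 (sel3 x.2.2 h0 h1 h2)) &&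
      pd c2 x.1 0))))

def schemeChk (g : List Nat) (cs c2 c3 : List (Nat × Nat)) (h0 h1 h2 : Nat)
    (f : List (Nat × Nat × Nat)) : Bool :=
  force g.length fun n => force (Nat.pred (pw n)) fun full =>
  Nat.blt 0 n && (Nat.ble n 16 && (dead g 1 0 ((0, full) :: addF full f cs) &&
    ((allLt n fun i => (tb h0 i && isZ (Nat.land (nth g i) h0)) ||
      ((tb h1 i && isZ (Nat.land (nth g i) h1)) || (tb h2 i && isZ (Nat.land (nth g i) h2)))) &&
    (f.all (entChk full h0 h1 h2 c2) &&
    ((f.all fun x => f.all fun y => pairChk c2 x y) && f.all (triChk c2 c3 f))))))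

inductive Cert where
  | crit (g c1 : List Nat) (S : List (Nat × Nat × List Nat)) (a b : Nat) (T : List Nat)
  | scheme (g c1 : List Nat) (h0 h1 h2 : Nat) (f : List (Nat × Nat × Nat)) (c2 c3 : List Nat)

def Cert.graph : Cert → List Nat
  | .crit g _ _ _ _ _ => g
  | .scheme g _ _ _ _ _ _ _ => g

def check (prev : List (List Nat)) : Cert → Bool
  | .crit g c1 S a b T =>
    force (Nat.pred (pw g.length)) fun full =>
    critChk g (cubes prev g [0] g.length full c1 []) S a b T
  | .scheme g c1 h0 h1 h2 f c2 c3 =>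
    force (Nat.pred (pw g.length)) fun full =>
    schemeChk g (cubes prev g [0] g.length full c1 []) (cubes prev g [2, 1] g.length full c2 [])
      (cubes prev g [6, 1, 1] g.length full c3 []) h0 h1 h2 f

/-- Check all certificates in order; the last graph must be the one we are interested in. -/
def run : List (List Nat) → List Cert → Bool
  | prev, [] => nthL prev 0 == [18, 5, 42, 20, 41, 20]
  | prev, c :: t => (symChk c.graph && check prev c) && run (c.graph :: prev) t

def forkG : List Nat := [46, 1, 1, 17, 8, 65, 32]


/-! ## Soundness of the checker: bit masks and cubes -/

theorem isZ_iff (n : Nat) : isZ n = true ↔ n = 0 := by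
  unfold isZ; rw [Nat.beq_eq]

theorem force_eq {α : Type} (n : Nat) (f : Nat → α) : force n f = f n := by
  cases n <;> rfl

theorem pw_eq (k : Nat) : pw k = 2 ^ k := by
  show 1 <<< k = 2 ^ k
  simp [Nat.shiftLeft_eq]

theorem tb_eq (m k : Nat) : tb m k = m.testBit k := by
  show Nat.beq ((m >>> k) &&& 1) 1 = m.testBit k
  rw [Nat.testBit, Nat.and_comm 1]
  have : (m >>> k) &&& 1 = 0 ∨ (m >>> k) &&& 1 = 1 := by
    rw [Nat.and_one_is_mod]; omega
  rcases this with h | h <;> rw [h] <;> rfl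

theorem land_eq_zero_iff (a b : Nat) :
    a &&& b = 0 ↔ ∀ j, a.testBit j = true → b.testBit j = true → False := by
  constructor
  · intro h j ha hb
    have := congrArg (fun x => Nat.testBit x j) h
    simp [ha, hb] at this
  · intro h
    apply Nat.eq_of_testBit_eq
    intro j
    rw [Nat.testBit_and, Nat.zero_testBit]
    cases ha : a.testBit j <;> cases hb : b.testBit j <;> simp
    exact h j ha hb

theorem land_eq_left_iff (a b : Nat) :
    a &&& b = a ↔ ∀ j, a.testBit j = true → b.testBit j = true := by
  constructor
  · intro h j ha
    have := congrArg (fun x => Nat.testBit x j) h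
    simpa [ha] using this
  · intro h
    apply Nat.eq_of_testBit_eq
    intro j
    rw [Nat.testBit_and]
    cases ha : a.testBit j <;> simp
    exact h j ha

theorem hit_iff (x : Nat × Nat) (M : Nat) : hit x M = true ↔
    (∀ j, x.1.testBit j = true → M.testBit j = true) ∧
    (∀ j, x.2.testBit j = true → M.testBit j = true → False) := by
  rw [← land_eq_left_iff, ← land_eq_zero_iff]
  unfold hit
  rw [Bool.and_eq_true, isZ_iff, Nat.beq_eq]
  rfl

theorem nth_zero (x : Nat) (l : List Nat) : nth (x :: l) 0 = x := rfl
theorem nth_succ (x : Nat) (l : List Nat) (k : Nat) : nth (x :: l) (k + 1) = nth l k := rfl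

theorem nthL_mem (l : List (List Nat)) : ∀ k, nthL l k ∈ l ∨ nthL l k = [1] := by
  induction l with
  | nil => intro k; right; rfl
  | cons x l ih =>
    intro k
    cases k with
    | zero => left; exact List.mem_cons_self
    | succ k =>
      rcases ih k with h | h
      · left; exact List.mem_cons_of_mem _ h
      · right; exact h

theorem filt_sound (b b2 m : Nat) (v : Bool) (l : List (Nat × Nat)) : ∀ acc,
    (filt b b2 m v l acc = none → ∃ x ∈ l, x.1 < b2 ∧ x.2 < b2 ∧ hit x m = true) ∧
    (∀ r, filt b b2 m v l acc = some r → ∀ x ∈ r, x ∈ l ∨ x ∈ acc) := by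
  induction l with
  | nil =>
    intro acc
    refine ⟨fun h => ?_, fun r h x hx => ?_⟩
    · cases h
    · right
      have : acc = r := Option.some.inj h
      rw [this]; exact hx
  | cons y l ih =>
    intro acc
    have e : filt b b2 m v (y :: l) acc =
      bif isZ (Nat.land (bif v then y.2 else y.1) b) then
      (bif (Nat.blt y.1 b2 && (Nat.blt y.2 b2 && hit y m)) then none
        else filt b b2 m v l (y :: acc))
      else filt b b2 m v l acc := rfl
    rw [e]
    cases isZ (Nat.land (bif v then y.2 else y.1) b) with
    | false =>
      simp only [cond_false]
      refine ⟨fun h => ?_, fun r h x hx => ?_⟩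
      · obtain ⟨x, hx, h'⟩ := (ih acc).1 h
        exact ⟨x, List.mem_cons_of_mem _ hx, h'⟩
      · rcases (ih acc).2 r h x hx with h' | h'
        · left; exact List.mem_cons_of_mem _ h'
        · right; exact h'
    | true =>
      simp only [cond_true]
      cases hc : (Nat.blt y.1 b2 && (Nat.blt y.2 b2 && hit y m)) with
      | false =>
        simp only [cond_false]
        refine ⟨fun h => ?_, fun r h x hx => ?_⟩
        · obtain ⟨x, hx, h'⟩ := (ih _).1 h
          exact ⟨x, List.mem_cons_of_mem _ hx, h'⟩
        · rcases (ih _).2 r h x hx with h' | h'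
          · left; exact List.mem_cons_of_mem _ h'
          · rcases List.mem_cons.1 h' with rfl | h'
            · left; exact List.mem_cons_self
            · right; exact h'
      | true =>
        simp only [cond_true]
        rw [Bool.and_eq_true, Bool.and_eq_true, Nat.blt_eq, Nat.blt_eq] at hc
        refine ⟨fun _ => ⟨y, List.mem_cons_self, hc.1, hc.2.1, hc.2.2⟩, fun r h => ?_⟩
        cases h

theorem hit_of_mod {x : Nat × Nat} {M k : Nat} (h2 : x.2 < 2 ^ k)
    (h : hit x (M % 2 ^ k) = true) : hit x M = true := by
  rw [hit_iff] at h ⊢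
  refine ⟨fun j hj => ?_, fun j hj hM => ?_⟩
  · have := h.1 j hj
    rw [Nat.testBit_mod_two_pow] at this
    simp at this
    exact this.2
  · apply h.2 j hj
    rw [Nat.testBit_mod_two_pow]
    have : j < k := by
      by_contra hk
      have := Nat.testBit_lt_two_pow
        (lt_of_lt_of_le h2 (Nat.pow_le_pow_right (by norm_num) (not_lt.1 hk)))
      rw [hj] at this
      cases this
    simp [this, hM]

theorem dead_sound (M : Nat) (rows : List Nat) : ∀ (k : Nat) (cs : List (Nat × Nat)),
    dead rows (2 ^ k) (M % 2 ^ k) cs = true →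
    (∀ i < rows.length, M.testBit (k + i) = true → nth rows i &&& M = 0) →
    ∃ x ∈ cs, hit x M = true := by
  induction rows with
  | nil => intro k cs h; cases h
  | cons r rows ih =>
    intro k cs h htri
    have e : dead (r :: rows) (2 ^ k) (M % 2 ^ k) cs =
      (force (Nat.add (2 ^ k) (2 ^ k)) fun b2 =>
        (Option.rec true (fun c => dead rows b2 (M % 2 ^ k) c)
          (filt (2 ^ k) b2 (M % 2 ^ k) false cs []) : Bool) &&
        (!isZ (Nat.land r (M % 2 ^ k)) || force (Nat.add (M % 2 ^ k) (2 ^ k)) fun m2 =>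
          (Option.rec true (fun c => dead rows b2 m2 c) (filt (2 ^ k) b2 m2 true cs []) : Bool))) := rfl
    rw [e, force_eq, force_eq, show Nat.add (2 ^ k) (2 ^ k) = 2 ^ (k + 1) by
      rw [pow_succ]; show 2 ^ k + 2 ^ k = _; omega] at h
    rw [Bool.and_eq_true] at h
    have htri' : ∀ i < rows.length, M.testBit (k + 1 + i) = true → nth rows i &&& M = 0 := by
      intro i hi hM
      exact htri (i + 1) (by simpa using hi) (by rw [← hM]; congr 1; omega)
    have key : ∀ (v : Bool) (m2 : Nat), M % 2 ^ (k + 1) = m2 →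
        (Option.rec true (fun c => dead rows (2 ^ (k + 1)) m2 c)
          (filt (2 ^ k) (2 ^ (k + 1)) m2 v cs []) : Bool) = true → ∃ x ∈ cs, hit x M = true := by
      intro v m2 hm h
      cases hf : filt (2 ^ k) (2 ^ (k + 1)) m2 v cs [] with
      | none =>
        obtain ⟨x, hx, _, h2, h3⟩ := (filt_sound _ _ _ _ _ _).1 hf
        exact ⟨x, hx, hit_of_mod h2 (hm ▸ h3)⟩
      | some c =>
        rw [hf] at h
        have h' : dead rows (2 ^ (k + 1)) m2 c = true := h
        subst hm
        obtain ⟨x, hx, h3⟩ := ih _ _ h' htri'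
        refine ⟨x, ?_, h3⟩
        simpa using (filt_sound _ _ _ _ _ _).2 _ hf x hx
    cases hb : M.testBit k with
    | false =>
      refine key false (M % 2 ^ k) ?_ h.1
      apply Nat.eq_of_testBit_eq
      intro j
      simp only [Nat.testBit_mod_two_pow]
      rcases Nat.lt_trichotomy j k with hj | hj | hj
      · simp [hj, Nat.lt_succ_of_lt hj]
      · subst hj; simp [hb]
      · have : ¬ j < k + 1 := by omega
        have : ¬ j < k := by omega
        simp [*]
    | true =>
      have hz := htri 0 (by simp) (by simpa using hb)
      have : isZ (Nat.land r (M % 2 ^ k)) = true := by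
        rw [isZ_iff]
        show r &&& (M % 2 ^ k) = 0
        rw [land_eq_zero_iff] at hz ⊢
        intro j h1 h2
        rw [Nat.testBit_mod_two_pow] at h2
        simp at h2
        exact hz j h1 h2.2
      rw [this] at h
      refine key true (Nat.add (M % 2 ^ k) (2 ^ k)) ?_ (by simpa using h.2)
      show M % 2 ^ (k + 1) = M % 2 ^ k + 2 ^ k
      rw [Nat.testBit_eq_decide_div_mod_eq, decide_eq_true_eq] at hb
      rw [Nat.mod_pow_succ, hb, Nat.mul_one]

/-! ### Patterns -/

theorem digs_length (l : List Nat) : ∀ c, (digs l c).length = l.length := by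
  induction l with
  | nil => intro c; rfl
  | cons x l ih =>
    intro c
    have e : digs (x :: l) c = force (Nat.land c 31) fun d =>
      force (Nat.shiftRight c 5) fun c => d :: digs l c := rfl
    rw [e, force_eq, force_eq]
    simp [ih]

theorem pows_eq (l : List Nat) : pows l = l.map (fun s => 2 ^ s) := by
  induction l with
  | nil => rfl
  | cons x l ih =>
    have e : pows (x :: l) = force (pw x) fun p => p :: pows l := rfl
    rw [e, force_eq, ih, pw_eq]; rfl

theorem dis_sound (ss : List Nat) : ∀ (acc X : Nat), dis (pows ss) acc = some X →
    ss.Nodup ∧ (∀ s ∈ ss, acc.testBit s = false) ∧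
    (∀ b, X.testBit b = true ↔ acc.testBit b = true ∨ b ∈ ss) := by
  induction ss with
  | nil =>
    intro acc X h
    have : acc = X := Option.some.inj h
    subst this
    simp
  | cons s ss ih =>
    intro acc X h
    have e : dis (pows (s :: ss)) acc = bif isZ (Nat.land (2 ^ s) acc) then
        force (Nat.lor acc (2 ^ s)) fun a => dis (pows ss) a else none := by
      rw [pows_eq, pows_eq]; rfl
    rw [e, force_eq] at h
    cases hz : isZ (Nat.land (2 ^ s) acc) with
    | false => rw [hz] at h; cases h
    | true =>
      rw [hz] at h
      have h' : dis (pows ss) (acc ||| 2 ^ s) = some X := h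
      rw [isZ_iff] at hz
      have hz' : 2 ^ s &&& acc = 0 := hz
      rw [land_eq_zero_iff] at hz'
      have hs : acc.testBit s = false := by
        cases hh : acc.testBit s
        · rfl
        · exact (hz' s (Nat.testBit_two_pow_self) hh).elim
      obtain ⟨h1, h2, h3⟩ := ih _ _ h'
      have h2' : ∀ t ∈ ss, acc.testBit t = false ∧ s ≠ t := by
        intro t ht
        have := h2 t ht
        simpa [Nat.testBit_or, Nat.testBit_two_pow] using this
      refine ⟨?_, ?_, ?_⟩
      · rw [List.nodup_cons]
        exact ⟨fun hm => (h2' s hm).2 rfl, h1⟩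
      · intro t ht
        rcases List.mem_cons.1 ht with rfl | ht
        · exact hs
        · exact (h2' t ht).1
      · intro b
        rw [h3 b, Nat.testBit_or, Nat.testBit_two_pow, List.mem_cons]
        simp only [Bool.or_eq_true, decide_eq_true_eq]
        constructor
        · rintro ((h | h) | h)
          · exact Or.inl h
          · exact Or.inr (Or.inl h.symm)
          · exact Or.inr (Or.inr h)
        · rintro (h | h | h)
          · exact Or.inl (Or.inl h)
          · exact Or.inl (Or.inr h.symm)
          · exact Or.inr h

theorem nth_mem {l : List Nat} : ∀ {i}, i < l.length → nth l i ∈ l := by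
  induction l with
  | nil => intro i h; simp at h
  | cons x l ih =>
    intro i h
    cases i with
    | zero => exact List.mem_cons_self
    | succ i => exact List.mem_cons_of_mem _ (ih (by simpa using h))

theorem nth_inj {l : List Nat} (hl : l.Nodup) : ∀ {i j}, i < l.length → j < l.length →
    nth l i = nth l j → i = j := by
  induction l with
  | nil => intro i j h; simp at h
  | cons x l ih =>
    rw [List.nodup_cons] at hl
    intro i j hi hj h
    cases i with
    | zero =>
      cases j with
      | zero => rfl
      | succ j =>
        have h' : x = nth l j := h
        exact (hl.1 (h' ▸ nth_mem (by simpa using hj))).elim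
    | succ i =>
      cases j with
      | zero =>
        have h' : nth l i = x := h
        exact (hl.1 (h' ▸ nth_mem (by simpa using hi))).elim
      | succ j =>
        have := ih hl.2 (by simpa using hi) (by simpa using hj) h
        omega

theorem img_sound (ss : List Nat) : ∀ (row b : Nat), (img row (pows ss)).testBit b = true ↔
    ∃ i < ss.length, row.testBit i = true ∧ nth ss i = b := by
  induction ss with
  | nil =>
    intro row b
    have : img row (pows []) = 0 := rfl
    rw [this]; simp
  | cons s ss ih =>
    intro row b
    have e : img row (pows (s :: ss)) = force (Nat.shiftRight row 1) fun r =>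
        bif isZ (Nat.land row 1) then img r (pows ss) else Nat.lor (2 ^ s) (img r (pows ss)) := by
      rw [pows_eq, pows_eq]; rfl
    rw [e, force_eq]
    have hih : ∀ b, (img (Nat.shiftRight row 1) (pows ss)).testBit b = true ↔
        ∃ i < ss.length, row.testBit (i + 1) = true ∧ nth ss i = b := by
      intro b
      rw [ih]
      have : ∀ i, (Nat.shiftRight row 1).testBit i = row.testBit (i + 1) := by
        intro i
        show (row >>> 1).testBit i = _
        rw [Nat.testBit_shiftRight, Nat.add_comm]
      simp only [this]
    have h0 : isZ (Nat.land row 1) = !row.testBit 0 := by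
      have := tb_eq row 0
      have h2 : tb row 0 = Nat.beq (Nat.land row 1) 1 := rfl
      rw [← this, h2]
      have h3 : Nat.land row 1 = 0 ∨ Nat.land row 1 = 1 := by
        show row &&& 1 = 0 ∨ row &&& 1 = 1
        rw [Nat.and_one_is_mod]; omega
      rcases h3 with h | h <;> rw [h] <;> rfl
    rw [h0]
    have step : (∃ i < (s :: ss).length, row.testBit i = true ∧ nth (s :: ss) i = b) ↔
        (row.testBit 0 = true ∧ s = b) ∨ ∃ i < ss.length, row.testBit (i + 1) = true ∧ nth ss i = b := by
      constructor
      · rintro ⟨i, hi, h1, h2⟩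
        cases i with
        | zero => exact Or.inl ⟨h1, h2⟩
        | succ i => exact Or.inr ⟨i, by simpa using hi, h1, h2⟩
      · rintro (⟨h1, h2⟩ | ⟨i, hi, h1, h2⟩)
        · exact ⟨0, by simp, h1, h2⟩
        · exact ⟨i + 1, by simpa using hi, h1, h2⟩
    rw [step]
    cases hr : row.testBit 0 with
    | false =>
      simp only [Bool.not_false, cond_true]
      rw [hih]; simp
    | true =>
      simp only [Bool.not_true, cond_false]
      rw [show Nat.lor (2 ^ s) (img (Nat.shiftRight row 1) (pows ss)) =
        2 ^ s ||| (img (Nat.shiftRight row 1) (pows ss)) from rfl, Nat.testBit_or, Bool.or_eq_true,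
        hih, Nat.testBit_two_pow]
      simp

theorem img_nth {ss : List Nat} (hss : ss.Nodup) (row : Nat) {j : Nat} (hj : j < ss.length) :
    (img row (pows ss)).testBit (nth ss j) = row.testBit j := by
  rw [Bool.eq_iff_iff, img_sound]
  constructor
  · rintro ⟨i, hi, h1, h2⟩
    rwa [← nth_inj hss hi hj h2]
  · intro h
    exact ⟨j, hj, h, rfl⟩

def RowOK (g NA : List Nat) (n full Xo Xn : Nat) (I s : Nat) (x : Nat × Nat) : Prop :=
  (s < n ∧ nth g s &&& Xo = I &&& full) ∨
  (n ≤ s ∧ s - n < NA.length ∧ nth NA (s - n) &&& Xn = I >>> n ∧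
    (∀ j, ((I &&& full) <<< (16 * (s - n))).testBit j = true → x.1.testBit j = true) ∧
    (∀ j, ((Xo ^^^ (I &&& full)) <<< (16 * (s - n))).testBit j = true → x.2.testBit j = true))

theorem rowsChk_sound (g NA : List Nat) (n full Xo Xn : Nat) (ps : List Nat) (x : Nat × Nat)
    (pg : List Nat) : ∀ ss P Q, rowsChk g NA n full Xo Xn ps pg ss P Q = some x →
    (∀ j, P.testBit j = true → x.1.testBit j = true) ∧
    (∀ j, Q.testBit j = true → x.2.testBit j = true) ∧
    (∀ i < pg.length, RowOK g NA n full Xo Xn (img (nth pg i) ps) (nth ss i) x) := by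
  induction pg with
  | nil =>
    intro ss P Q h
    have : (P, Q) = x := Option.some.inj h
    subst this
    simp
  | cons r pg ih =>
    intro ss P Q h
    cases ss with
    | nil => cases h
    | cons s st =>
      have e : rowsChk g NA n full Xo Xn ps (r :: pg) (s :: st) P Q =
        force (img r ps) fun I =>
        bif Nat.blt s n then
          (bif Nat.beq (Nat.land (nth g s) Xo) (Nat.land I full) then
            rowsChk g NA n full Xo Xn ps pg st P Q else none)
        else
          (bif Nat.blt (Nat.sub s n) NA.length &&
              Nat.beq (Nat.land (nth NA (Nat.sub s n)) Xn) (Nat.shiftRight I n) then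
            force (Nat.lor P (Nat.shiftLeft (Nat.land I full) (Nat.mul 16 (Nat.sub s n)))) fun P2 =>
            force (Nat.lor Q (Nat.shiftLeft (Nat.xor Xo (Nat.land I full))
              (Nat.mul 16 (Nat.sub s n)))) fun Q2 =>
            rowsChk g NA n full Xo Xn ps pg st P2 Q2
          else none) := rfl
      rw [e, force_eq, force_eq, force_eq] at h
      have fin : ∀ {p : Prop}, p → (p → RowOK g NA n full Xo Xn (img r ps) s x) →
          (∀ i < pg.length, RowOK g NA n full Xo Xn (img (nth pg i) ps) (nth st i) x) →
          (∀ i < (r :: pg).length,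
            RowOK g NA n full Xo Xn (img (nth (r :: pg) i) ps) (nth (s :: st) i) x) := by
        intro p hp h1 h2 i hi
        cases i with
        | zero => exact h1 hp
        | succ i => exact h2 i (by simpa using hi)
      cases hs : Nat.blt s n with
      | true =>
        rw [hs] at h
        simp only [cond_true] at h
        cases hb : Nat.beq (Nat.land (nth g s) Xo) (Nat.land (img r ps) full) with
        | false => rw [hb] at h; cases h
        | true =>
          rw [hb] at h
          simp only [cond_true] at h
          obtain ⟨h1, h2, h3⟩ := ih _ _ _ h
          refine ⟨h1, h2, fin trivial (fun _ => Or.inl ⟨?_, ?_⟩) h3⟩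
          · rwa [Nat.blt_eq] at hs
          · rw [Nat.beq_eq] at hb; exact hb
      | false =>
        rw [hs] at h
        simp only [cond_false] at h
        cases hb : (Nat.blt (Nat.sub s n) NA.length &&
              Nat.beq (Nat.land (nth NA (Nat.sub s n)) Xn) (Nat.shiftRight (img r ps) n)) with
        | false => rw [hb] at h; cases h
        | true =>
          rw [hb] at h
          simp only [cond_true] at h
          obtain ⟨h1, h2, h3⟩ := ih _ _ _ h
          rw [Bool.and_eq_true, Nat.blt_eq, Nat.beq_eq] at hb
          have g1 : ∀ j, (P ||| ((img r ps &&& full) <<< (16 * (s - n)))).testBit j = true →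
            x.1.testBit j = true := h1
          have g2 : ∀ j, (Q ||| ((Xo ^^^ (img r ps &&& full)) <<< (16 * (s - n)))).testBit j = true →
            x.2.testBit j = true := h2
          refine ⟨fun j hj => g1 j ?_, fun j hj => g2 j ?_,
            fin trivial (fun _ => Or.inr ⟨?_, hb.1, hb.2, fun j hj => g1 j ?_, fun j hj => g2 j ?_⟩) h3⟩
          · rw [Nat.testBit_or, hj]; rfl
          · rw [Nat.testBit_or, hj]; rfl
          · by_contra hc
            rw [(Nat.blt_eq).mpr (not_le.1 hc)] at hs
            cases hs
          · rw [Nat.testBit_or, hj, Bool.or_true]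
          · rw [Nat.testBit_or, hj, Bool.or_true]

theorem allLt_iff (n : Nat) (f : Nat → Bool) : allLt n f = true ↔ ∀ i < n, f i = true := by
  induction n with
  | zero => simp [allLt]
  | succ n ih =>
    have e : allLt (n + 1) f = (f n && allLt n f) := rfl
    rw [e, Bool.and_eq_true, ih]
    constructor
    · rintro ⟨h1, h2⟩ i hi
      rcases Nat.lt_succ_iff_lt_or_eq.1 hi with h | rfl
      · exact h2 i h
      · exact h1
    · intro h
      exact ⟨h n (by omega), fun i hi => h i (by omega)⟩

theorem symChk_iff (g : List Nat) : symChk g = true ↔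
    ∀ i < g.length, ∀ j < g.length, (nth g i).testBit j = (nth g j).testBit i := by
  unfold symChk
  simp only [allLt_iff, tb_eq, beq_iff_eq]

section

/-! ### Realizations in a graph -/

variable {V : Type} {G : SimpleGraph V}

structure Realizes (G : SimpleGraph V) (g : List Nat) (vs : Nat → V) : Prop where
  inj : ∀ i < g.length, ∀ j < g.length, vs i = vs j → i = j
  adj : ∀ i < g.length, ∀ j < g.length, (G.Adj (vs i) (vs j) ↔ (nth g i).testBit j = true)

/-- symmetric and not an induced subgraph -/
structure Refuted (G : SimpleGraph V) (g : List Nat) : Prop where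
  sym : ∀ i < g.length, ∀ j < g.length, (nth g i).testBit j = (nth g j).testBit i
  ref : ∀ vs, ¬ Realizes G g vs

theorem refuted_loop (G : SimpleGraph V) : Refuted G [1] := by
  refine ⟨fun i hi j hj => ?_, fun vs h => ?_⟩
  · have : i = j := by simp at hi hj; omega
    rw [this]
  · have := (h.adj 0 (by simp) 0 (by simp)).2 (by decide)
    exact G.loopless.irrefl _ this

theorem refuted_nthL {prev : List (List Nat)} (hp : ∀ p ∈ prev, Refuted G p) (k : Nat) :
    Refuted G (nthL prev k) := by
  rcases nthL_mem prev k with h | h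
  · exact hp _ h
  · rw [h]; exact refuted_loop G

/-- A realization together with new vertices, described by `NA` and `M`. -/
structure Ext (G : SimpleGraph V) (g : List Nat) (vs : Nat → V) (NA : List Nat) (ws : Nat → V)
    (M : Nat) : Prop where
  real : Realizes G g vs
  fresh : ∀ a < NA.length, ∀ i < g.length, ws a ≠ vs i
  winj : ∀ a < NA.length, ∀ b < NA.length, ws a = ws b → a = b
  wadj : ∀ a < NA.length, ∀ b < NA.length, (G.Adj (ws a) (ws b) ↔ (nth NA a).testBit b = true)
  madj : ∀ a < NA.length, ∀ j < g.length, (G.Adj (ws a) (vs j) ↔ M.testBit (16 * a + j) = true)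

theorem testBit_full (n j : Nat) : (2 ^ n - 1).testBit j = decide (j < n) :=
  Nat.testBit_two_pow_sub_one n j

theorem clauseAux_sound {g NA pg ss : List Nat} {vs ws : Nat → V} {M : Nat} {x : Nat × Nat}
    (he : Ext G g vs NA ws M) (hpg : Refuted G pg) (hlen : ss.length = pg.length)
    (h : clauseAux g NA g.length (2 ^ g.length - 1) pg ss = some x) (hM : hit x M = true) :
    False := by
  unfold clauseAux at h
  cases hd : dis (pows ss) 0 with
  | none => rw [hd] at h; cases h
  | some X =>
    rw [hd] at h
    simp only [force_eq] at h
    obtain ⟨hnd, -, hX⟩ := dis_sound _ _ _ hd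
    obtain ⟨-, -, hrow⟩ := rowsChk_sound _ _ _ _ _ _ _ _ _ _ _ _ h
    rw [hit_iff] at hM
    set n := g.length with hn
    have hXs : ∀ j < pg.length, X.testBit (nth ss j) = true := fun j hj =>
      (hX _).2 (Or.inr (nth_mem (by omega)))
    have hXo : ∀ j < pg.length, nth ss j < n →
        (Nat.land X (2 ^ n - 1)).testBit (nth ss j) = true := by
      intro j hj hs
      show (X &&& (2 ^ n - 1)).testBit _ = _
      rw [Nat.testBit_and, testBit_full, hXs j hj]
      simpa using hs
    have hI : ∀ i < pg.length, ∀ j < pg.length, nth ss j < n →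
        (img (nth pg i) (pows ss) &&& (2 ^ n - 1)).testBit (nth ss j) = (nth pg i).testBit j := by
      intro i hi j hj hs
      rw [Nat.testBit_and, testBit_full, img_nth hnd _ (by omega)]
      simp [hs]
    apply hpg.ref (fun i => if nth ss i < n then vs (nth ss i) else ws (nth ss i - n))
    have new_old : ∀ i < pg.length, ∀ j < pg.length, ¬ nth ss i < n → nth ss j < n →
        (G.Adj (ws (nth ss i - n)) (vs (nth ss j)) ↔ (nth pg i).testBit j = true) := by
      intro i hi j hj h1 h2
      rcases hrow i hi with h3 | ⟨h3, h4, h5, h6, h7⟩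
      · exact absurd h3.1 h1
      rw [he.madj _ h4 _ h2, ← hI i hi j hj h2]
      cases hb : (img (nth pg i) (pows ss) &&& (2 ^ n - 1)).testBit (nth ss j) with
      | true =>
        simp only [iff_true]
        apply hM.1
        apply h6
        rw [Nat.testBit_shiftLeft, Nat.add_sub_cancel_left, hb]
        simp
      | false =>
        simp only [Bool.false_eq_true, iff_false]
        intro hMM
        refine hM.2 _ (h7 _ ?_) hMM
        rw [Nat.testBit_shiftLeft, Nat.testBit_xor, Nat.add_sub_cancel_left, hb, hXo j hj h2]
        simp
    refine ⟨fun i hi j hj hij => ?_, fun i hi j hj => ?_⟩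
    · by_cases h1 : nth ss i < n <;> by_cases h2 : nth ss j < n
      · rw [if_pos h1, if_pos h2] at hij
        exact nth_inj hnd (by omega) (by omega) (he.real.inj _ h1 _ h2 hij)
      · rw [if_pos h1, if_neg h2] at hij
        rcases hrow j hj with h3 | ⟨h3, h4, -⟩
        · exact absurd h3.1 h2
        · exact absurd hij.symm (he.fresh _ h4 _ h1)
      · rw [if_neg h1, if_pos h2] at hij
        rcases hrow i hi with h3 | ⟨h3, h4, -⟩
        · exact absurd h3.1 h1
        · exact absurd hij (he.fresh _ h4 _ h2)
      · rw [if_neg h1, if_neg h2] at hij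
        rcases hrow i hi with h3 | ⟨h3, h4, -⟩
        · exact absurd h3.1 h1
        rcases hrow j hj with h5 | ⟨h5, h6, -⟩
        · exact absurd h5.1 h2
        have := he.winj _ h4 _ h6 hij
        exact nth_inj hnd (by omega) (by omega) (by omega)
    · by_cases h1 : nth ss i < n <;> by_cases h2 : nth ss j < n
      · rw [if_pos h1, if_pos h2, he.real.adj _ h1 _ h2, ← hI i hi j hj h2]
        rcases hrow i hi with h3 | ⟨h3, h4, -⟩
        · rw [← h3.2, Nat.testBit_and, hXo j hj h2, Bool.and_true]
        · omega
      · rw [if_pos h1, if_neg h2, G.adj_comm, hpg.sym i hi j hj]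
        exact new_old j hj i hi h2 h1
      · rw [if_neg h1, if_pos h2]
        exact new_old i hi j hj h1 h2
      · rw [if_neg h1, if_neg h2]
        rcases hrow i hi with h3 | ⟨h3, h4, h7, -⟩
        · exact absurd h3.1 h1
        rcases hrow j hj with h5 | ⟨h5, h6, -⟩
        · exact absurd h5.1 h2
        rw [he.wadj _ h4 _ h6, ← img_nth hnd (nth pg i) (by omega : j < ss.length)]
        have e1 : nth ss j = n + (nth ss j - n) := by omega
        have e2 := congrArg (fun t => Nat.testBit t (nth ss j - n)) h7
        simp only [Nat.testBit_and, Nat.testBit_shiftRight] at e2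
        rw [← e1] at e2
        rw [← e2]
        have e3 : (Nat.shiftRight X n).testBit (nth ss j - n) = true := by
          show (X >>> n).testBit _ = _
          rw [Nat.testBit_shiftRight, ← e1]
          exact hXs j hj
        rw [e3, Bool.and_true]

theorem cubes_mem (prev : List (List Nat)) (g NA : List Nat) (n full : Nat) (cs : List Nat) :
    ∀ acc x, x ∈ cubes prev g NA n full cs acc →
      x ∈ acc ∨ ∃ code, clause prev g NA n full code = some x := by
  induction cs with
  | nil => intro acc x h; exact Or.inl h
  | cons c t ih =>
    intro acc x h
    unfold cubes at h
    cases hc : clause prev g NA n full c with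
    | none => rw [hc] at h; exact ih _ _ h
    | some y =>
      rw [hc] at h
      rcases ih _ _ h with h | h
      · rcases List.mem_cons.1 h with rfl | h
        · exact Or.inr ⟨c, hc⟩
        · exact Or.inl h
      · exact Or.inr h

theorem cubes_sound {prev : List (List Nat)} (hp : ∀ p ∈ prev, Refuted G p) {g NA cs : List Nat}
    {vs ws : Nat → V} {M : Nat} {x : Nat × Nat} (he : Ext G g vs NA ws M)
    (hx : x ∈ cubes prev g NA g.length (2 ^ g.length - 1) cs []) (hM : hit x M = true) : False := by
  rcases cubes_mem _ _ _ _ _ _ _ _ hx with h | ⟨code, h⟩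
  · simp at h
  · exact clauseAux_sound he (refuted_nthL hp _) (digs_length _ _) h hM

/-- A mask describing the neighbourhood of a vertex. -/
theorem exists_mask (G : SimpleGraph V) (vs : Nat → V) (w : V) (n : Nat) :
    ∃ M < 2 ^ n, ∀ j, (M.testBit j = true ↔ j < n ∧ G.Adj w (vs j)) := by
  classical
  induction n with
  | zero => exact ⟨0, by simp, by simp⟩
  | succ n ih =>
    obtain ⟨M, hM, h⟩ := ih
    by_cases ha : G.Adj w (vs n)
    · refine ⟨M ||| 2 ^ n, Nat.or_lt_two_pow (by rw [pow_succ]; omega) (by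
        rw [pow_succ]; have := Nat.two_pow_pos n; omega), fun j => ?_⟩
      rw [Nat.testBit_or, Bool.or_eq_true, h, Nat.testBit_two_pow]
      simp only [decide_eq_true_eq]
      constructor
      · rintro (⟨h1, h2⟩ | rfl)
        · exact ⟨by omega, h2⟩
        · exact ⟨by omega, ha⟩
      · rintro ⟨h1, h2⟩
        by_cases hj : n = j
        · exact Or.inr hj
        · exact Or.inl ⟨by omega, h2⟩
    · refine ⟨M, by rw [pow_succ]; omega, fun j => ?_⟩
      rw [h]
      constructor
      · rintro ⟨h1, h2⟩
        exact ⟨by omega, h2⟩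
      · rintro ⟨h1, h2⟩
        refine ⟨?_, h2⟩
        by_contra hj
        exact ha ((show j = n by omega) ▸ h2)

/-- triangle-freeness -/
def TF (G : SimpleGraph V) : Prop := ∀ a b c, G.Adj a b → G.Adj b c → G.Adj a c → False

/-- If the cubes cover everything then some cube contains the mask of `w`. -/
theorem dead_vertex (ht : TF G) {g : List Nat} {vs : Nat → V} (hr : Realizes G g vs) {w : V}
    {M : Nat} (hM : ∀ j, (M.testBit j = true ↔ j < g.length ∧ G.Adj w (vs j)))
    {cs : List (Nat × Nat)} (h : dead g 1 0 cs = true) : ∃ x ∈ cs, hit x M = true := by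
  refine dead_sound M g 0 cs ?_ ?_
  · simpa [Nat.mod_one] using h
  · intro i hi hMi
    rw [land_eq_zero_iff]
    intro j h1 h2
    rw [Nat.zero_add, hM] at hMi
    rw [hM] at h2
    exact ht _ _ _ hMi.2 ((hr.adj i hi j h2.1).2 h1) h2.2

theorem ext_one {g : List Nat} {vs : Nat → V} (hr : Realizes G g vs) {w : V}
    (hw : ∀ i < g.length, w ≠ vs i) {M : Nat}
    (hM : ∀ j, (M.testBit j = true ↔ j < g.length ∧ G.Adj w (vs j))) :
    Ext G g vs [0] (fun _ => w) M := by
  refine ⟨hr, fun _ _ => hw, fun a ha b hb _ => ?_, fun a ha b hb => ?_, fun a ha j hj => ?_⟩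
  · simp at ha hb; omega
  · have : a = 0 := by simpa using ha
    subst this
    rw [nth_zero]
    simp
  · have : a = 0 := by simpa using ha
    subst this
    rw [Nat.mul_zero, Nat.zero_add, hM]
    simp [hj]

/-! ### Soundness of the deletion certificates -/

/-- What we use about the minimal counterexample. -/
structure Hyp (G : SimpleGraph V) : Prop where
  tf : TF G
  nocol : ∀ f : V → Nat, (∀ v, f v < 3) → (∀ u v, G.Adj u v → f u ≠ f v) → False
  crit : ∀ S : Set V, S.Nonempty → ∃ f : V → Nat, (∀ v, f v < 3) ∧
    ∀ u v, u ∉ S → v ∉ S → G.Adj u v → f u ≠ f v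

theorem addR_mem (l : List Nat) (acc : List (Nat × Nat)) :
    ∀ x ∈ addR l acc, (∃ r ∈ l, x = (r, 0)) ∨ x ∈ acc := by
  induction l with
  | nil => intro x hx; exact Or.inr hx
  | cons r l ih =>
    intro x hx
    have hx' : x ∈ (r, 0) :: addR l acc := hx
    rcases List.mem_cons.1 hx' with h | h
    · exact Or.inl ⟨r, List.mem_cons_self, h⟩
    · rcases ih x h with ⟨q, hq, h⟩ | h
      · exact Or.inl ⟨q, List.mem_cons_of_mem _ hq, h⟩
      · exact Or.inr h

theorem maskS_iff (S : List (Nat × Nat × List Nat)) (t : Nat) :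
    (maskS S).testBit t = true ↔ ∃ e ∈ S, e.1 = t := by
  induction S with
  | nil => simp [maskS]
  | cons e S ih =>
    have e1 : maskS (e :: S) = 2 ^ e.1 ||| maskS S := by rw [← pw_eq]; rfl
    rw [e1, Nat.testBit_or, Bool.or_eq_true, ih, Nat.testBit_two_pow]
    simp

theorem tryC_iff (gs : Nat) (R : List Nat) (φ ψ : Nat) : tryC gs R φ ψ = true ↔
    gs &&& φ = 0 ∧ gs &&& ψ = 0 ∧ ∀ r ∈ R, r &&& φ ≠ 0 := by
  unfold tryC
  rw [Bool.and_eq_true, isZ_iff, List.all_eq_true]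
  have h1 : Nat.land gs (Nat.lor φ ψ) = 0 ↔ gs &&& φ = 0 ∧ gs &&& ψ = 0 := by
    show gs &&& (φ ||| ψ) = 0 ↔ _
    rw [Nat.and_or_distrib_left, Nat.or_eq_zero_iff]
  have h2 : ∀ r, (!isZ (Nat.land r φ)) = true ↔ r &&& φ ≠ 0 := by
    intro r
    rw [Bool.not_eq_true', ← Bool.not_eq_true, isZ_iff]
    rfl
  rw [h1, and_assoc]
  simp only [h2]

/-- properties of the colour classes chosen on the deleted set -/
structure ClassOK (G : SimpleGraph V) (g : List Nat) (vs : Nat → V)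
    (S : List (Nat × Nat × List Nat)) (φa φ ψ : Nat) : Prop where
  ent : ∀ s, ψ.testBit s = true → ∃ e ∈ S, e.1 = s ∧ φa &&& e.2.1 = e.2.1 ∧
    nth g s &&& φ = 0 ∧ ∀ r ∈ e.2.2, r &&& φ ≠ 0
  ind : ∀ s s', ψ.testBit s = true → ψ.testBit s' = true → ¬ G.Adj (vs s) (vs s')

theorem okS_sound {g : List Nat} {vs : Nat → V} (hr : Realizes G g vs)
    {S0 : List (Nat × Nat × List Nat)} (hS0 : ∀ e ∈ S0, e.1 < g.length) (φ : Nat → Nat)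
    (S : List (Nat × Nat × List Nat)) : ∀ ψ : Nat → Nat, (∀ e ∈ S, e ∈ S0) →
    (∀ c < 3, ClassOK G g vs S0 (φ 0 ||| (φ 1 ||| φ 2)) (φ c) (ψ c)) →
    okS g (φ 0) (φ 1) (φ 2) S (ψ 0) (ψ 1) (ψ 2) = true →
    ∃ ψ' : Nat → Nat, (∀ c < 3, ClassOK G g vs S0 (φ 0 ||| (φ 1 ||| φ 2)) (φ c) (ψ' c)) ∧
      (∀ c s, (ψ c).testBit s = true → (ψ' c).testBit s = true) ∧
      (∀ e ∈ S, ∃ c < 3, (ψ' c).testBit e.1 = true) := by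
  induction S with
  | nil => intro ψ _ hψ _; exact ⟨ψ, hψ, fun _ _ h => h, by simp⟩
  | cons e S ih =>
    intro ψ hS hψ h
    unfold okS at h
    rw [Bool.and_eq_true, Nat.beq_eq] at h
    obtain ⟨hneed, h⟩ := h
    have hneed' : (φ 0 ||| (φ 1 ||| φ 2)) &&& e.2.1 = e.2.1 := hneed
    have key : ∀ c < 3, tryC (nth g e.1) e.2.2 (φ c) (ψ c) = true →
        okS g (φ 0) (φ 1) (φ 2) S (Function.update ψ c (ψ c ||| 2 ^ e.1) 0)
          (Function.update ψ c (ψ c ||| 2 ^ e.1) 1)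
          (Function.update ψ c (ψ c ||| 2 ^ e.1) 2) = true →
        ∃ ψ' : Nat → Nat,
          (∀ c < 3, ClassOK G g vs S0 (φ 0 ||| (φ 1 ||| φ 2)) (φ c) (ψ' c)) ∧
          (∀ c s, (ψ c).testBit s = true → (ψ' c).testBit s = true) ∧
          (∀ e' ∈ e :: S, ∃ c < 3, (ψ' c).testBit e'.1 = true) := by
      intro c hc ht ho
      rw [tryC_iff] at ht
      obtain ⟨t1, t2, t3⟩ := ht
      have he0 : e ∈ S0 := hS e List.mem_cons_self
      have hlt : ∀ s, (ψ c).testBit s = true → s < g.length := by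
        intro s hs
        obtain ⟨e', he', h', -⟩ := (hψ c hc).ent s hs
        rw [← h']; exact hS0 _ he'
      have hna : ∀ s, (ψ c).testBit s = true → ¬ G.Adj (vs e.1) (vs s) := by
        intro s hs ha
        rw [hr.adj _ (hS0 _ he0) _ (hlt s hs)] at ha
        exact (land_eq_zero_iff _ _).1 t2 s ha hs
      obtain ⟨ψ', h1, h2, h3⟩ := ih _ (fun e' he' => hS e' (List.mem_cons_of_mem _ he')) (by
        intro d hd
        by_cases hdc : d = c
        · subst hdc
          rw [Function.update_self]
          have hbit : ∀ s, (ψ d ||| 2 ^ e.1).testBit s = true →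
              (ψ d).testBit s = true ∨ e.1 = s := by
            intro s hs
            rw [Nat.testBit_or, Bool.or_eq_true, Nat.testBit_two_pow] at hs
            simpa using hs
          refine ⟨fun s hs => ?_, fun s s' hs hs' => ?_⟩
          · rcases hbit s hs with h | rfl
            · exact (hψ d hc).ent s h
            · exact ⟨e, he0, rfl, hneed', t1, t3⟩
          · rcases hbit s hs with h | rfl <;> rcases hbit s' hs' with h' | rfl
            · exact (hψ d hc).ind _ _ h h'
            · intro ha; exact hna _ h ha.symm
            · exact hna _ h'
            · exact G.loopless.irrefl _
        · rw [Function.update_of_ne hdc]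
          exact hψ d hd) ho
      have hmono : ∀ d s, (ψ d).testBit s = true → (ψ' d).testBit s = true := by
        intro d s hs
        apply h2
        by_cases hdc : d = c
        · subst hdc
          rw [Function.update_self, Nat.testBit_or, hs]; rfl
        · rw [Function.update_of_ne hdc]; exact hs
      refine ⟨ψ', h1, hmono, ?_⟩
      intro e' he'
      rcases List.mem_cons.1 he' with rfl | he'
      · refine ⟨c, hc, h2 _ _ ?_⟩
        rw [Function.update_self, Nat.testBit_or, Nat.testBit_two_pow_self, Bool.or_true]
      · exact h3 _ he'
    simp only [pw_eq] at h
    rw [Bool.or_eq_true, Bool.or_eq_true, Bool.and_eq_true, Bool.and_eq_true,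
      Bool.and_eq_true] at h
    rcases h with h | h | h
    · exact key 0 (by norm_num) h.1 h.2
    · exact key 1 (by norm_num) h.1 h.2
    · exact key 2 (by norm_num) h.1 h.2

def Sub (g : List Nat) (vs : Nat → V) (SS : Set V) (Φ : V → Nat) (φ : Nat → Nat) : Prop :=
  ∀ c < 3, ∀ t, (φ c).testBit t = true → t < g.length ∧ vs t ∉ SS ∧ Φ (vs t) = c

theorem col_sound {g : List Nat} {vs : Nat → V} (hr : Realizes G g vs) {SS : Set V} {Φ : V → Nat}
    (h3 : ∀ v, Φ v < 3) (hΦ : ∀ u v, u ∉ SS → v ∉ SS → G.Adj u v → Φ u ≠ Φ v)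
    (S : List (Nat × Nat × List Nat)) (T : List Nat) : ∀ φ : Nat → Nat, Sub g vs SS Φ φ →
    (∀ t ∈ T, t < g.length ∧ vs t ∉ SS) → col g S T (φ 0) (φ 1) (φ 2) = true →
    ∃ φ' : Nat → Nat, Sub g vs SS Φ φ' ∧ okS g (φ' 0) (φ' 1) (φ' 2) S 0 0 0 = true := by
  induction T with
  | nil =>
    intro φ hφ _ h
    exact ⟨φ, hφ, h⟩
  | cons t T ih =>
    intro φ hφ hT h
    unfold col at h
    simp only [force_eq, pw_eq] at h
    rw [Bool.or_eq_true] at h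
    rcases h with h | h
    · exact ⟨φ, hφ, h⟩
    obtain ⟨ht1, ht2⟩ := hT t List.mem_cons_self
    have hz : isZ (Nat.land (nth g t) (φ (Φ (vs t)))) = true := by
      rw [isZ_iff]
      show nth g t &&& _ = 0
      rw [land_eq_zero_iff]
      intro j h1 h2
      obtain ⟨h4, h5, h6⟩ := hφ _ (h3 _) j h2
      exact hΦ _ _ ht2 h5 ((hr.adj _ ht1 _ h4).2 h1) h6.symm
    have key : col g S T (Function.update φ (Φ (vs t)) (φ (Φ (vs t)) ||| 2 ^ t) 0)
        (Function.update φ (Φ (vs t)) (φ (Φ (vs t)) ||| 2 ^ t) 1)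
        (Function.update φ (Φ (vs t)) (φ (Φ (vs t)) ||| 2 ^ t) 2) = true := by
      simp only [Bool.and_eq_true] at h
      have hlt := h3 (vs t)
      generalize Φ (vs t) = c at hz hlt
      have : c = 0 ∨ c = 1 ∨ c = 2 := by omega
      rcases this with rfl | rfl | rfl
      · have h := h.1
        rw [hz] at h
        exact h
      · have h := h.2.1
        rw [hz] at h
        exact h
      · have h := h.2.2
        rw [hz] at h
        exact h
    refine ih _ ?_ (fun s hs => hT s (List.mem_cons_of_mem _ hs)) key
    intro c hc s hs
    by_cases hcc : c = Φ (vs t)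
    · subst hcc
      rw [Function.update_self, Nat.testBit_or, Bool.or_eq_true, Nat.testBit_two_pow] at hs
      rcases hs with hs | hs
      · exact hφ _ hc s hs
      · have : t = s := by simpa using hs
        subst this
        exact ⟨ht1, ht2, rfl⟩
    · rw [Function.update_of_ne hcc] at hs
      exact hφ _ hc s hs

theorem inT_iff (n Sm t : Nat) : inT n Sm t = true ↔ t < n ∧ ¬ Sm.testBit t = true := by
  unfold inT
  rw [Bool.and_eq_true, Nat.blt_eq, tb_eq]
  simp

theorem exists_normalize (x y : Nat) (hx : x < 3) (hy : y < 3) (hxy : x ≠ y) :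
    ∃ π : Nat → Nat, (∀ z, π z < 3) ∧ (∀ z < 3, ∀ z' < 3, π z = π z' → z = z') ∧
      π x = 0 ∧ π y = 1 := by
  refine ⟨fun z => if z = x then 0 else if z = y then 1 else 2, ?_, ?_, ?_, ?_⟩
  · intro z
    dsimp only
    split_ifs <;> norm_num
  · dsimp only
    intro z hz z' hz'
    interval_cases x <;> interval_cases y <;> interval_cases z <;> interval_cases z' <;> simp_all
  · simp
  · simp [hxy.symm]

theorem crit_sound (hG : Hyp G) {prev : List (List Nat)} (hp : ∀ p ∈ prev, Refuted G p)
    {g c1 : List Nat} {vs : Nat → V} (hr : Realizes G g vs) {S : List (Nat × Nat × List Nat)}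
    {a b : Nat} {T : List Nat}
    (h : critChk g (cubes prev g [0] g.length (2 ^ g.length - 1) c1 []) S a b T = true) :
    False := by
  unfold critChk at h
  simp only [force_eq, Bool.and_eq_true, List.all_eq_true, inT_iff] at h
  obtain ⟨hne, hcS, hT, ha, hb, hcol⟩ := h
  set n := g.length with hn
  set SS : Set V := {v | ∃ e ∈ S, v = vs e.1} with hSS
  have hS0 : ∀ e ∈ S, e.1 < n := by
    intro e he
    have := hcS e he
    unfold critS at this
    rw [Bool.and_eq_true, Nat.blt_eq] at this
    exact this.1
  have hout : ∀ t < n, ¬ (maskS S).testBit t = true → vs t ∉ SS := by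
    rintro t ht hm ⟨e, he, h⟩
    apply hm
    rw [maskS_iff]
    exact ⟨e, he, (hr.inj _ ht _ (hS0 e he) h).symm⟩
  have hSne : SS.Nonempty := by
    cases S with
    | nil => simp at hne
    | cons e S => exact ⟨vs e.1, e, List.mem_cons_self, rfl⟩
  obtain ⟨Φ0, hΦ0, hΦp⟩ := hG.crit SS hSne
  have haS := hout a ha.1 ha.2
  have hbS := hout b hb.1 hb.2
  -- normalise the colouring
  have hnorm : ∃ Φ : V → Nat, (∀ v, Φ v < 3) ∧
      (∀ u v, u ∉ SS → v ∉ SS → G.Adj u v → Φ u ≠ Φ v) ∧ ∃ φ : Nat → Nat, Sub g vs SS Φ φ ∧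
        col g S T (φ 0) (φ 1) (φ 2) = true := by
    have aux : ∀ y < 3, Φ0 (vs a) ≠ y → ∃ Φ : V → Nat, (∀ v, Φ v < 3) ∧
        (∀ u v, u ∉ SS → v ∉ SS → G.Adj u v → Φ u ≠ Φ v) ∧ Φ (vs a) = 0 ∧
        ∀ v, Φ0 v = y → Φ v = 1 := by
      intro y hy hne
      obtain ⟨π, h1, h2, h3, h4⟩ := exists_normalize _ y (hΦ0 (vs a)) hy hne
      refine ⟨fun v => π (Φ0 v), fun v => h1 _, fun u v hu hv huv he => ?_, h3, fun v hv => ?_⟩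
      · exact hΦp u v hu hv huv (h2 _ (hΦ0 _) _ (hΦ0 _) he)
      · dsimp only; rw [hv]; exact h4
    cases hab : Nat.beq a b with
    | true =>
      rw [hab] at hcol
      obtain ⟨Φ, h1, h2, h3, -⟩ := aux (if Φ0 (vs a) = 0 then 1 else 0) (by split_ifs <;> norm_num)
        (by split_ifs <;> omega)
      refine ⟨Φ, h1, h2, fun c => if c = 0 then 2 ^ a else 0, ?_, ?_⟩
      · intro c hc t ht
        dsimp only at ht
        by_cases h0 : c = 0
        · subst h0
          rw [if_pos rfl, Nat.testBit_two_pow] at ht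
          have : a = t := by simpa using ht
          subst this
          exact ⟨ha.1, haS, h3⟩
        · rw [if_neg h0] at ht
          simp at ht
      · simpa [pw_eq] using hcol
    | false =>
      rw [hab] at hcol
      simp only [cond_false, Bool.and_eq_true, tb_eq, pw_eq] at hcol
      have hadj : G.Adj (vs a) (vs b) := (hr.adj _ ha.1 _ hb.1).2 hcol.1
      obtain ⟨Φ, h1, h2, h3, h4⟩ := aux (Φ0 (vs b)) (hΦ0 _) (hΦp _ _ haS hbS hadj)
      refine ⟨Φ, h1, h2, fun c => if c = 0 then 2 ^ a else if c = 1 then 2 ^ b else 0, ?_, ?_⟩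
      · intro c hc t ht
        dsimp only at ht
        by_cases h0 : c = 0
        · subst h0
          rw [if_pos rfl, Nat.testBit_two_pow] at ht
          have : a = t := by simpa using ht
          subst this
          exact ⟨ha.1, haS, h3⟩
        · rw [if_neg h0] at ht
          by_cases h00 : c = 1
          · subst h00
            rw [if_pos rfl, Nat.testBit_two_pow] at ht
            have : b = t := by simpa using ht
            subst this
            exact ⟨hb.1, hbS, h4 _ rfl⟩
          · rw [if_neg h00] at ht
            simp at ht
      · simpa using hcol.2
  clear hΦ0 hΦp Φ0
  obtain ⟨Φ, hΦ3, hΦ, φ0, hφ0, hcol⟩ := hnorm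
  obtain ⟨φ, hφ, hok⟩ := col_sound hr hΦ3 hΦ S T φ0 hφ0
    (fun t ht => ⟨(hT t ht).1, hout t (hT t ht).1 (hT t ht).2⟩) hcol
  obtain ⟨ψ, hψ, -, hψS⟩ := okS_sound hr hS0 φ S (fun _ => 0) (fun e he => he)
    (fun c _ => ⟨by simp, by simp⟩) hok
  -- the new colouring
  have hchoice : ∀ v, ∃ c, c < 3 ∧ (v ∈ SS → ∃ s, v = vs s ∧ (ψ c).testBit s = true) ∧
      (v ∉ SS → c = Φ v) := by
    intro v
    by_cases hv : v ∈ SS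
    · obtain ⟨e, he, rfl⟩ := hv
      obtain ⟨c, hc, h⟩ := hψS e he
      exact ⟨c, hc, fun _ => ⟨_, rfl, h⟩, fun h => absurd ⟨e, he, rfl⟩ h⟩
    · exact ⟨Φ v, hΦ3 v, fun h => absurd h hv, fun _ => rfl⟩
  choose f hf3 hfS hfO using hchoice
  have mixed : ∀ u v, u ∈ SS → v ∉ SS → G.Adj u v → f u ≠ f v := by
    intro u v hu hv huv hfe
    obtain ⟨s, hus, hs⟩ := hfS u hu
    obtain ⟨e, he, hes, h1, h2, h3⟩ := (hψ _ (hf3 u)).ent s hs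
    have hc : Φ v = f u := by rw [hfe, hfO v hv]
    have hsn : s < n := hes ▸ hS0 e he
    -- a neighbour of `v` in the colour class of `u` is impossible
    have conc : ∀ r ∈ e.2.2, (∀ t < n, r.testBit t = true → G.Adj v (vs t)) → False := by
      intro r hrm hadj
      apply h3 r hrm
      rw [land_eq_zero_iff]
      intro t ht1 ht2
      obtain ⟨q1, q2, q3⟩ := hφ _ (hf3 u) t ht2
      exact hΦ _ _ hv q2 (hadj t q1 ht1) (by rw [hc, q3])
    have hcr := hcS e he
    unfold critS at hcr
    simp only [Bool.and_eq_true, allLt_iff, Bool.or_eq_true, tb_eq, List.any_eq_true,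
      Nat.beq_eq] at hcr
    obtain ⟨-, hdead, hw⟩ := hcr
    by_cases hvH : ∃ w < n, v = vs w
    · obtain ⟨w, hwn, rfl⟩ := hvH
      have hgs : (nth g s).testBit w = true := (hr.adj _ hsn _ hwn).1 (hus ▸ huv)
      rcases hw w hwn with h | h | h | ⟨r, hrm, h⟩
      · rw [hes, hgs] at h; cases h
      · rw [maskS_iff] at h
        obtain ⟨e', he', h'⟩ := h
        exact hv ⟨e', he', by rw [h']⟩
      · have h' : (φ 0 ||| (φ 1 ||| φ 2)).testBit w = true := by
          have := congrArg (fun t => Nat.testBit t w) h1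
          simp only [Nat.testBit_and, h, Bool.and_true] at this
          exact this
        have hcls : ∃ c < 3, (φ c).testBit w = true := by
          rw [Nat.testBit_or, Nat.testBit_or, Bool.or_eq_true, Bool.or_eq_true] at h'
          rcases h' with h' | h' | h'
          · exact ⟨0, by norm_num, h'⟩
          · exact ⟨1, by norm_num, h'⟩
          · exact ⟨2, by norm_num, h'⟩
        obtain ⟨c, hc3, hcw⟩ := hcls
        have := (hφ c hc3 w hcw).2.2
        rw [hc] at this
        subst this
        exact (land_eq_zero_iff _ _).1 h2 w hgs hcw
      · refine conc r hrm (fun t ht hrt => (hr.adj _ hwn _ ht).2 ?_)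
        exact (land_eq_left_iff _ _).1 h t hrt
    · obtain ⟨M, -, hM⟩ := exists_mask G vs v n
      obtain ⟨x, hx, hxM⟩ := dead_vertex hG.tf hr hM hdead
      rcases List.mem_cons.1 hx with rfl | hx
      · rw [hit_iff] at hxM
        refine hxM.2 s ?_ ((hM s).2 ⟨hsn, hus ▸ huv.symm⟩)
        rw [pw_eq, hes]
        exact Nat.testBit_two_pow_self
      · rcases addR_mem _ _ _ hx with ⟨r, hrm, rfl⟩ | hx
        · rw [hit_iff] at hxM
          exact conc r hrm (fun t _ hrt => ((hM t).1 (hxM.1 t hrt)).2)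
        · exact cubes_sound hp (ext_one hr (fun i hi h => hvH ⟨i, hi, h⟩) hM) hx hxM
  refine hG.nocol f hf3 ?_
  intro u v huv
  by_cases hu : u ∈ SS <;> by_cases hv : v ∈ SS
  · intro hfe
    obtain ⟨s, hus, hs⟩ := hfS u hu
    obtain ⟨s', hvs, hs'⟩ := hfS v hv
    rw [← hfe] at hs'
    apply (hψ _ (hf3 u)).ind s s' hs hs'
    rw [← hus, ← hvs]
    exact huv
  · exact mixed u v hu hv huv
  · exact (mixed v u hv hu huv.symm).symm
  · rw [hfO u hu, hfO v hv]
    exact hΦ u v hu hv huv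

/-! ### Soundness of the colouring scheme certificates -/

theorem addF_mem (full : Nat) (l : List (Nat × Nat × Nat)) (acc : List (Nat × Nat)) :
    ∀ x ∈ addF full l acc, (∃ e ∈ l, x = (e.1, full ^^^ e.1)) ∨ x ∈ acc := by
  induction l with
  | nil => intro x hx; exact Or.inr hx
  | cons r l ih =>
    intro x hx
    unfold addF at hx
    rw [force_eq] at hx
    rcases List.mem_cons.1 hx with h | h
    · exact Or.inl ⟨r, List.mem_cons_self, h⟩
    · rcases ih x h with ⟨q, hq, h⟩ | h
      · exact Or.inl ⟨q, List.mem_cons_of_mem _ hq, h⟩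
      · exact Or.inr h

/-- `m` is the mask of the outside vertex `w` -/
structure IsMask (G : SimpleGraph V) (g : List Nat) (vs : Nat → V) (w : V) (m : Nat) : Prop where
  out : ∀ i < g.length, w ≠ vs i
  bit : ∀ j, (m.testBit j = true ↔ j < g.length ∧ G.Adj w (vs j))

theorem anyHit_sound {prev : List (List Nat)} (hp : ∀ p ∈ prev, Refuted G p)
    {g NA cs : List Nat} {vs ws : Nat → V} {M : Nat} (he : Ext G g vs NA ws M)
    (h : anyHit (cubes prev g NA g.length (2 ^ g.length - 1) cs []) M = true) : False := by
  unfold anyHit at h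
  rw [List.any_eq_true] at h
  obtain ⟨x, hx, hxM⟩ := h
  exact cubes_sound hp he hx hxM

theorem isMask_high {g : List Nat} {vs : Nat → V} {w : V} {m : Nat} (h : IsMask G g vs w m)
    {j : Nat} (hj : g.length ≤ j) : m.testBit j = false := by
  cases hb : m.testBit j with
  | false => rfl
  | true =>
    have := ((h.bit j).1 hb).1
    omega

theorem isMask_low {g : List Nat} {vs : Nat → V} {w : V} {m : Nat} (h : IsMask G g vs w m)
    {j : Nat} (hj : j < g.length) : m.testBit j = true ↔ G.Adj w (vs j) := by
  rw [h.bit]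
  simp [hj]

theorem ext_two {g : List Nat} (hn : g.length ≤ 16) {vs : Nat → V} (hr : Realizes G g vs)
    {w1 w2 : V} {m1 m2 : Nat} (h1 : IsMask G g vs w1 m1) (h2 : IsMask G g vs w2 m2)
    (ha : G.Adj w1 w2) :
    Ext G g vs [2, 1] (fun a => if a = 0 then w1 else w2) (m1 ||| m2 <<< 16) := by
  have hc : ∀ a < [2, 1].length, a = 0 ∨ a = 1 := by
    intro a ha; simp at ha; omega
  refine ⟨hr, fun a ha i hi => ?_, fun a ha' b hb' => ?_, fun a ha' b hb' => ?_,
    fun a ha' j hj => ?_⟩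
  · rcases hc a ha with rfl | rfl
    · exact h1.out i hi
    · exact h2.out i hi
  · rcases hc a ha' with rfl | rfl <;> rcases hc b hb' with rfl | rfl <;>
      simp [ha.ne, ha.ne.symm]
  · rcases hc a ha' with rfl | rfl <;> rcases hc b hb' with rfl | rfl <;>
      simp [ha, ha.symm, nth_zero, nth_succ] <;> decide
  · rw [Nat.testBit_or, Nat.testBit_shiftLeft]
    rcases hc a ha' with rfl | rfl
    · have : ¬ 16 ≤ j := by omega
      simp [this, isMask_low h1 hj]
    · have e1 := isMask_high h1 (show g.length ≤ 16 + j by omega)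
      simp [e1, isMask_low h2 hj]

theorem ext_three {g : List Nat} (hn : g.length ≤ 16) {vs : Nat → V} (hr : Realizes G g vs)
    {w1 w2 w3 : V} {m1 m2 m3 : Nat} (h1 : IsMask G g vs w1 m1) (h2 : IsMask G g vs w2 m2)
    (h3 : IsMask G g vs w3 m3) (ha : G.Adj w1 w2) (hb : G.Adj w1 w3) (hne : w2 ≠ w3)
    (hna : ¬ G.Adj w2 w3) :
    Ext G g vs [6, 1, 1] (fun a => if a = 0 then w1 else if a = 1 then w2 else w3)
      (m1 ||| (m2 <<< 16 ||| m3 <<< 32)) := by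
  have hc : ∀ a < [6, 1, 1].length, a = 0 ∨ a = 1 ∨ a = 2 := by
    intro a ha; simp at ha; omega
  have hna' : ¬ G.Adj w3 w2 := fun h => hna h.symm
  refine ⟨hr, fun a ha i hi => ?_, fun a ha' b hb' => ?_, fun a ha' b hb' => ?_,
    fun a ha' j hj => ?_⟩
  · rcases hc a ha with rfl | rfl | rfl
    · exact h1.out i hi
    · exact h2.out i hi
    · exact h3.out i hi
  · rcases hc a ha' with rfl | rfl | rfl <;> rcases hc b hb' with rfl | rfl | rfl <;>
      simp [ha.ne, ha.ne.symm, hb.ne, hb.ne.symm, hne, hne.symm]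
  · rcases hc a ha' with rfl | rfl | rfl <;> rcases hc b hb' with rfl | rfl | rfl <;>
      simp [ha, ha.symm, hb, hb.symm, hna, hna', nth_zero, nth_succ] <;> decide
  · rw [Nat.testBit_or, Nat.testBit_or, Nat.testBit_shiftLeft, Nat.testBit_shiftLeft]
    rcases hc a ha' with rfl | rfl | rfl
    · have e1 : ¬ 16 ≤ j := by omega
      have e2 : ¬ 32 ≤ j := by omega
      simp [e1, e2, isMask_low h1 hj]
    · have e1 := isMask_high h1 (show g.length ≤ 16 + j by omega)
      have e2 : ¬ 32 ≤ 16 + j := by omega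
      simp [e1, e2, isMask_low h2 hj]
    · have e1 := isMask_high h1 (show g.length ≤ 32 + j by omega)
      have e2 := isMask_high h2 (show g.length ≤ 32 + j - 16 by omega)
      simp [e1, e2, isMask_low h3 hj]

theorem pd_sound (ht : TF G) {prev : List (List Nat)} (hp : ∀ p ∈ prev, Refuted G p)
    {g c2 : List Nat} (hn : g.length ≤ 16) {vs : Nat → V} (hr : Realizes G g vs)
    {w1 w2 : V} {m1 m2 : Nat} (h1 : IsMask G g vs w1 m1) (h2 : IsMask G g vs w2 m2)
    (ha : G.Adj w1 w2)
    (h : pd (cubes prev g [2, 1] g.length (2 ^ g.length - 1) c2 []) m1 m2 = true) : False := by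
  unfold pd at h
  rw [Bool.or_eq_true, Bool.or_eq_true, Bool.not_eq_true', ← Bool.not_eq_true, isZ_iff] at h
  rcases h with h | h | h
  · apply h
    show m1 &&& m2 = 0
    rw [land_eq_zero_iff]
    intro j q1 q2
    exact ht _ _ _ ha ((h2.bit j).1 q2).2 ((h1.bit j).1 q1).2
  · exact anyHit_sound hp (ext_two hn hr h1 h2 ha) h
  · exact anyHit_sound hp (ext_two hn hr h2 h1 ha.symm) h

theorem td_sound {prev : List (List Nat)} (hp : ∀ p ∈ prev, Refuted G p)
    {g c3 : List Nat} (hn : g.length ≤ 16) {vs : Nat → V} (hr : Realizes G g vs)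
    {w1 w2 w3 : V} {m1 m2 m3 : Nat} (h1 : IsMask G g vs w1 m1) (h2 : IsMask G g vs w2 m2)
    (h3 : IsMask G g vs w3 m3) (ha : G.Adj w1 w2) (hb : G.Adj w1 w3) (hne : w2 ≠ w3)
    (hna : ¬ G.Adj w2 w3)
    (h : td (cubes prev g [6, 1, 1] g.length (2 ^ g.length - 1) c3 []) m1 m2 m3 = true) : False :=
  anyHit_sound hp (ext_three hn hr h1 h2 h3 ha hb hne hna) h

/-- A minimal counterexample is connected. -/
theorem closed_false (hG : Hyp G) (Z : Set V) {z y : V} (hz : z ∈ Z) (hy : y ∉ Z)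
    (hcl : ∀ u v, u ∈ Z → G.Adj u v → v ∈ Z) : False := by
  classical
  obtain ⟨f1, h1, p1⟩ := hG.crit Z ⟨z, hz⟩
  obtain ⟨f2, h2, p2⟩ := hG.crit Zᶜ ⟨y, hy⟩
  refine hG.nocol (fun v => if v ∈ Z then f2 v else f1 v) (fun v => ?_) (fun u v huv => ?_)
  · split_ifs
    · exact h2 v
    · exact h1 v
  · by_cases hu : u ∈ Z
    · have hv := hcl u v hu huv
      simp only [hu, hv, if_true]
      exact p2 u v (fun h => h hu) (fun h => h hv) huv
    · have hv : v ∉ Z := fun h => hu (hcl v u h huv.symm)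
      simp only [hu, hv, if_false]
      exact p1 u v hu hv huv

theorem scheme_sound (hG : Hyp G) {prev : List (List Nat)} (hp : ∀ p ∈ prev, Refuted G p)
    {g c1 c2 c3 : List Nat} {vs : Nat → V} (hr : Realizes G g vs) {h0 h1 h2 : Nat}
    {f : List (Nat × Nat × Nat)}
    (h : schemeChk g (cubes prev g [0] g.length (2 ^ g.length - 1) c1 [])
      (cubes prev g [2, 1] g.length (2 ^ g.length - 1) c2 [])
      (cubes prev g [6, 1, 1] g.length (2 ^ g.length - 1) c3 []) h0 h1 h2 f = true) : False := by
  classical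
  unfold schemeChk at h
  have efull : Nat.pred (pw g.length) = 2 ^ g.length - 1 := by rw [pw_eq]; rfl
  simp only [force_eq, efull, Bool.and_eq_true, List.all_eq_true, allLt_iff, Nat.blt_eq] at h
  obtain ⟨hn0, hn16, hdead, hH, hent, hpair, htri⟩ := h
  replace hn16 : g.length ≤ 16 := Nat.le_of_ble_eq_true hn16
  set h : Nat → Nat := fun k => sel3 k h0 h1 h2 with hh
  -- colour the realized graph
  have hHcol : ∀ i < g.length, ∃ c < 3, (h c).testBit i = true ∧ nth g i &&& h c = 0 := by
    intro i hi
    have := hH i hi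
    simp only [Bool.or_eq_true, Bool.and_eq_true, tb_eq, isZ_iff] at this
    rcases this with q | q | q
    · exact ⟨0, by norm_num, q.1, q.2⟩
    · exact ⟨1, by norm_num, q.1, q.2⟩
    · exact ⟨2, by norm_num, q.1, q.2⟩
  have hE : ∀ e ∈ f, e.2.1 < 3 ∧ e.2.2 < 3 ∧ e.1 &&& h e.2.1 = 0 ∧ e.1 &&& h e.2.2 = 0 ∧
      pd (cubes prev g [2, 1] g.length (2 ^ g.length - 1) c2 []) e.1 0 = true := by
    intro e he
    have := hent e he
    unfold entChk at this
    simp only [Bool.and_eq_true, isZ_iff, Nat.blt_eq] at this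
    exact this.2
  -- masks of outside vertices
  have hmask0 : ∀ w, (∀ i < g.length, w ≠ vs i) →
      IsMask G g vs w 0 ∨ ∃ e ∈ f, IsMask G g vs w e.1 := by
    intro w hw
    obtain ⟨M, hMlt, hM⟩ := exists_mask G vs w g.length
    obtain ⟨x, hx, hxM⟩ := dead_vertex hG.tf hr hM hdead
    have hMm : IsMask G g vs w M := ⟨hw, hM⟩
    rcases List.mem_cons.1 hx with rfl | hx
    · left
      have : M = 0 := by
        apply Nat.eq_of_testBit_eq
        intro j
        rw [Nat.zero_testBit]
        cases hb : M.testBit j with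
        | false => rfl
        | true =>
          rw [hit_iff] at hxM
          refine (hxM.2 j ?_ hb).elim
          rw [testBit_full]
          simpa using ((hM j).1 hb).1
      rw [← this]; exact hMm
    · rcases addF_mem _ _ _ _ hx with ⟨e, he, rfl⟩ | hx
      · right
        refine ⟨e, he, ?_⟩
        have : M = e.1 := by
          apply Nat.eq_of_testBit_eq
          intro j
          rw [hit_iff] at hxM
          cases he' : e.1.testBit j with
          | true => exact hxM.1 j he'
          | false =>
            cases hb : M.testBit j with
            | false => rfl
            | true =>
              refine (hxM.2 j ?_ hb).elim
              dsimp only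
              rw [Nat.testBit_xor, testBit_full, he']
              simpa using ((hM j).1 hb).1
        rw [← this]; exact hMm
      · exact (cubes_sound hp (ext_one hr hw hM) hx hxM).elim
  have hmask : ∀ w, (∀ i < g.length, w ≠ vs i) → ∃ e ∈ f, IsMask G g vs w e.1 := by
    intro w hw
    rcases hmask0 w hw with hm | hm
    · exfalso
      refine closed_false hG {z | IsMask G g vs z 0} (z := w) (y := vs 0) hm ?_ ?_
      · intro (q : IsMask G g vs (vs 0) 0)
        exact q.out 0 hn0 rfl
      · intro u v (hu : IsMask G g vs u 0) huv
        have hv : ∀ i < g.length, v ≠ vs i := by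
          intro i hi hvi
          have := (hu.bit i).2 ⟨hi, hvi ▸ huv⟩
          simp at this
        rcases hmask0 v hv with q | ⟨e, he, q⟩
        · exact q
        · exact (pd_sound hG.tf hp hn16 hr q hu huv.symm (hE e he).2.2.2.2).elim
    · exact hm
  let Out : V → Prop := fun w => ∀ i < g.length, w ≠ vs i
  have hex : ∀ w, ∃ e : Nat × Nat × Nat, Out w → e ∈ f ∧ IsMask G g vs w e.1 := by
    intro w
    by_cases hw : Out w
    · obtain ⟨e, he, hm⟩ := hmask w hw
      exact ⟨e, fun _ => ⟨he, hm⟩⟩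
    · exact ⟨(0, 0, 0), fun q => absurd q hw⟩
  choose ent hentw using hex
  have hin : ∀ v, ∃ c, c < 3 ∧ (¬ Out v → ∃ i < g.length, v = vs i ∧ (h c).testBit i = true ∧
      nth g i &&& h c = 0) := by
    intro v
    by_cases hv : Out v
    · exact ⟨0, by norm_num, fun q => absurd hv q⟩
    · have : ∃ i < g.length, v = vs i := by
        by_contra hc
        exact hv (fun i hi hvi => hc ⟨i, hi, hvi⟩)
      obtain ⟨i, hi, rfl⟩ := this
      obtain ⟨c, hc, q⟩ := hHcol i hi
      exact ⟨c, hc, fun _ => ⟨i, hi, rfl, q⟩⟩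
  choose cin hcin3 hcin using hin
  let Bad : V → Prop := fun w => plain (ent w) = false ∧
    ∃ p, Out p ∧ plain (ent p) = true ∧ (ent p).2.1 = (ent w).2.1 ∧ G.Adj w p
  let cout : V → Nat := fun w => if Bad w then (ent w).2.2 else (ent w).2.1
  have hcout : ∀ w, cout w = (ent w).2.1 ∨ cout w = (ent w).2.2 := by
    intro w
    by_cases hb : Bad w
    · right; exact if_pos hb
    · left; exact if_neg hb
  have hplain : ∀ w, plain (ent w) = true → cout w = (ent w).2.1 := by
    intro w hw
    apply if_neg
    rintro ⟨q, -⟩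
    rw [hw] at q
    cases q
  -- mixed edges
  have mixed : ∀ u v, ¬ Out u → Out v → G.Adj u v → cin u ≠ cout v := by
    intro u v hu hv huv he
    obtain ⟨i, hi, rfl, q1, -⟩ := hcin u hu
    obtain ⟨hvf, hvm⟩ := hentw v hv
    have hb := (hvm.bit i).2 ⟨hi, huv.symm⟩
    obtain ⟨-, -, z1, z2, -⟩ := hE _ hvf
    rw [land_eq_zero_iff] at z1 z2
    rcases hcout v with q | q
    · rw [he, q] at q1
      exact z1 i hb q1
    · rw [he, q] at q1
      exact z2 i hb q1
  -- an edge between a flexible vertex and a plain one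
  have flex : ∀ u p, Out u → Out p → plain (ent u) = false → plain (ent p) = true →
      G.Adj u p → cout u ≠ cout p := by
    intro u p hu hpo hup hpp hadj he
    rw [hplain p hpp] at he
    by_cases hb : Bad u
    · have hcu : cout u = (ent u).2.2 := if_pos hb
      rw [hcu] at he
      obtain ⟨-, q, hqo, hqp, hqe, hqa⟩ := hb
      obtain ⟨huf, hum⟩ := hentw u hu
      obtain ⟨hpf, hpm⟩ := hentw p hpo
      obtain ⟨hqf, hqm⟩ := hentw q hqo
      have hqp' : q ≠ p := by
        rintro rfl
        have : plain (ent u) = true := by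
          unfold plain
          rw [Nat.beq_eq, ← hqe, he]
        rw [hup] at this
        cases this
      have t := htri _ huf
      unfold triChk at t
      simp only [hup, Bool.false_or, List.all_eq_true] at t
      have t1 := t _ hqf
      have e1 : (plain (ent q) && Nat.beq (ent q).2.1 (ent u).2.1) = true := by
        rw [hqp, Bool.true_and, Nat.beq_eq, hqe]
      rw [e1, Bool.not_true, Bool.false_or, Bool.or_eq_true] at t1
      rcases t1 with t1 | t1
      · exact pd_sound hG.tf hp hn16 hr hum hqm hqa t1
      · rw [List.all_eq_true] at t1
        have t2 := t1 _ hpf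
        have e2 : (plain (ent p) && Nat.beq (ent p).2.1 (ent u).2.2) = true := by
          rw [hpp, Bool.true_and, Nat.beq_eq, he]
        rw [e2, Bool.not_true, Bool.false_or, Bool.or_eq_true] at t2
        rcases t2 with t2 | t2
        · exact pd_sound hG.tf hp hn16 hr hum hpm hadj t2
        · exact td_sound hp hn16 hr hum hqm hpm hqa hadj hqp'
            (fun q1 => hG.tf _ _ _ hqa q1 hadj) t2
    · have hcu : cout u = (ent u).2.1 := if_neg hb
      rw [hcu] at he
      exact hb ⟨hup, p, hpo, hpp, he.symm, hadj⟩
  refine hG.nocol (fun v => if Out v then cout v else cin v) (fun v => ?_) (fun u v huv => ?_)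
  · by_cases hv : Out v
    · simp only [hv, if_true]
      have := hE _ (hentw v hv).1
      rcases hcout v with q | q <;> rw [q]
      · exact this.1
      · exact this.2.1
    · simp only [hv, if_false]
      exact hcin3 v
  · by_cases hu : Out u <;> by_cases hv : Out v
    · simp only [hu, hv, if_true]
      obtain ⟨huf, hum⟩ := hentw u hu
      obtain ⟨hvf, hvm⟩ := hentw v hv
      have hpd : pd (cubes prev g [2, 1] g.length (2 ^ g.length - 1) c2 []) (ent u).1 (ent v).1
          = true → False := pd_sound hG.tf hp hn16 hr hum hvm huv
      have hq := hpair _ huf _ hvf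
      unfold pairChk at hq
      cases pu : plain (ent u) <;> cases pv : plain (ent v)
      · rw [pu, pv] at hq
        simp only [cond_false, Bool.false_or, Bool.or_eq_true, Bool.and_eq_true,
          Bool.not_eq_true', ← Bool.not_eq_true, Nat.beq_eq] at hq
        rcases hq with hq | hq
        · obtain ⟨q1, q2, q3, q4⟩ := hq
          rcases hcout u with r | r <;> rcases hcout v with s | s <;> rw [r, s] <;> assumption
        · exact (hpd hq).elim
      · exact flex u v hu hv pu pv huv
      · exact (flex v u hv hu pv pu huv.symm).symm
      · rw [pu, pv] at hq
        simp only [cond_true, Bool.not_true, Bool.false_or, Bool.or_eq_true,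
          Bool.not_eq_true', ← Bool.not_eq_true, Nat.beq_eq] at hq
        rcases hq with hq | hq
        · rw [hplain u pu, hplain v pv]
          exact hq
        · exact (hpd hq).elim
    · simp only [hu, hv, if_true, if_false]
      exact (mixed v u hv hu huv.symm).symm
    · simp only [hu, hv, if_true, if_false]
      exact mixed u v hu hv huv
    · simp only [hu, hv, if_false]
      obtain ⟨i, hi, e1, q1, q2⟩ := hcin u hu
      obtain ⟨j, hj, e2, q3, q4⟩ := hcin v hv
      intro he
      rw [← he] at q3
      rw [land_eq_zero_iff] at q2
      refine q2 j ?_ q3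
      rw [← hr.adj i hi j hj, ← e1, ← e2]
      exact huv

end

/-! ### The whole run -/

theorem check_sound {V : Type} {G : SimpleGraph V} (hG : Hyp G) {prev : List (List Nat)}
    (hp : ∀ p ∈ prev, Refuted G p) {c : Cert} (hs : symChk c.graph = true)
    (h : check prev c = true) : Refuted G c.graph := by
  refine ⟨(symChk_iff _).1 hs, fun vs hr => ?_⟩
  cases c with
  | crit g c1 S a b T =>
    unfold check at h
    dsimp only at h
    rw [force_eq, pw_eq] at h
    exact crit_sound hG hp hr h
  | scheme g c1 h0 h1 h2 f c2 c3 =>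
    unfold check at h
    dsimp only at h
    rw [force_eq, pw_eq] at h
    exact scheme_sound hG hp hr h

theorem run_sound {V : Type} {G : SimpleGraph V} (hG : Hyp G) (cs : List Cert) :
    ∀ prev : List (List Nat), (∀ p ∈ prev, Refuted G p) → run prev cs = true →
      Refuted G [18, 5, 42, 20, 41, 20] := by
  induction cs with
  | nil =>
    intro prev hp h
    unfold run at h
    rw [beq_iff_eq] at h
    rw [← h]
    exact refuted_nthL hp 0
  | cons c cs ih =>
    intro prev hp h
    unfold run at h
    rw [Bool.and_eq_true, Bool.and_eq_true] at h
    refine ih _ (fun p hpm => ?_) h.2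
    rcases List.mem_cons.1 hpm with rfl | hpm
    · exact check_sound hG hp h.1.1 h.1.2
    · exact hp p hpm

theorem refuted_forkG {V : Type} {G : SimpleGraph V} (h : ForkFree G) : Refuted G forkG := by
  refine ⟨(symChk_iff _).1 (by decide), fun vs hr => ?_⟩
  have key : ∀ i j : Fin 7, fork.Adj i j ↔ (nth forkG i.val).testBit j.val = true := by
    unfold fork
    simp only [SimpleGraph.fromEdgeSet_adj, Set.mem_insert_iff, Set.mem_singleton_iff]
    decide
  refine h.elim ⟨⟨fun i => vs i.val, fun i j hij => ?_⟩, fun {i j} => ?_⟩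
  · exact Fin.ext (hr.inj i.val i.isLt j.val j.isLt hij)
  · rw [key i j]
    exact hr.adj i.val i.isLt j.val j.isLt

theorem hyp_of_minCex {V : Type} [Fintype V] {G : SimpleGraph V} (hG : MinCex G) : Hyp G := by
  classical
  obtain ⟨h1, h2, h3, h4⟩ := hG
  refine ⟨fun a b c hab hbc hac => ?_, fun f hf hp => ?_, fun S hS => ?_⟩
  · exact h1 {a, b, c} (SimpleGraph.is3Clique_triple_iff.2 ⟨hab, hac, hbc⟩)
  · have hcol : G.Colorable 3 := ⟨SimpleGraph.Coloring.mk (fun v => (⟨f v, hf v⟩ : Fin 3))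
      (fun {u v} huv he => hp u v huv (congrArg Fin.val he))⟩
    have := h3.trans hcol.chromaticNumber_le
    norm_num at this
  · obtain ⟨z, hz⟩ := hS
    have hle := h4 {v : V // v ∉ S} (G.comap Subtype.val)
      (Fintype.card_subtype_lt (x := z) (by simpa using hz))
      (h1.comap ⟨(SimpleGraph.Embedding.comap (Function.Embedding.subtype _) G).toCopy⟩)
      ⟨fun e => h2.elim (e.trans (SimpleGraph.Embedding.comap (Function.Embedding.subtype _) G))⟩
    obtain ⟨C⟩ := (SimpleGraph.chromaticNumber_le_iff_colorable (n := 3)).1 hle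
    refine ⟨fun v => if hv : v ∉ S then (C ⟨v, hv⟩).val else 0, fun v => ?_,
      fun u v hu hv huv => ?_⟩
    · dsimp only
      split_ifs
      · norm_num
      · exact (C _).isLt
    · simp only [hu, hv, not_false_eq_true, dite_true]
      intro he
      exact C.valid (v := ⟨u, hu⟩) (w := ⟨v, hv⟩) huv (Fin.ext he)

theorem root_false {V : Type} {G : SimpleGraph V} (ht : TF G)
    (hr : Refuted G [18, 5, 42, 20, 41, 20]) {a0 a1 a2 a3 a4 x : V}
    (h01 : G.Adj a0 a1) (h12 : G.Adj a1 a2) (h23 : G.Adj a2 a3) (h34 : G.Adj a3 a4)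
    (h40 : G.Adj a4 a0) (hx2 : G.Adj a2 x) (hx4 : G.Adj a4 x) (hx3 : x ≠ a3) : False := by
  have n02 : ¬ G.Adj a0 a2 := fun h => ht _ _ _ h01 h12 h
  have n13 : ¬ G.Adj a1 a3 := fun h => ht _ _ _ h12 h23 h
  have n24 : ¬ G.Adj a2 a4 := fun h => ht _ _ _ h23 h34 h
  have n30 : ¬ G.Adj a3 a0 := fun h => ht _ _ _ h34 h40 h
  have n41 : ¬ G.Adj a4 a1 := fun h => ht _ _ _ h40 h01 h
  have n0x : ¬ G.Adj a0 x := fun h => ht _ _ _ h40 h hx4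
  have n1x : ¬ G.Adj a1 x := fun h => ht _ _ _ h12 hx2 h
  have n3x : ¬ G.Adj a3 x := fun h => ht _ _ _ h34 hx4 h
  have d02 : a0 ≠ a2 := fun h => n24 (h ▸ h40.symm)
  have d13 : a1 ≠ a3 := fun h => n30 (h ▸ h01.symm)
  have d24 : a2 ≠ a4 := fun h => n41 (h ▸ h12.symm)
  have d30 : a3 ≠ a0 := fun h => n02 (h ▸ h23.symm)
  have d41 : a4 ≠ a1 := fun h => n13 (h ▸ h34.symm)
  have dx0 : x ≠ a0 := fun h => n02 (h ▸ hx2.symm)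
  have dx1 : x ≠ a1 := fun h => n41 (h ▸ hx4)
  have L := @SimpleGraph.irrefl V G
  refine hr.ref (fun k => match k with
    | 0 => a0 | 1 => a1 | 2 => a2 | 3 => a3 | 4 => a4 | _ => x) ⟨?_, ?_⟩
  · intro i hi j hj
    simp only [List.length_cons, List.length_nil] at hi hj
    interval_cases i <;> interval_cases j <;>
      simp [h01.ne, h01.ne.symm, h12.ne, h12.ne.symm, h23.ne, h23.ne.symm, h34.ne, h34.ne.symm,
        h40.ne, h40.ne.symm, hx2.ne, hx2.ne.symm, hx4.ne, hx4.ne.symm, hx3, hx3.symm, d02,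
        d02.symm, d13, d13.symm, d24, d24.symm, d30, d30.symm, d41, d41.symm, dx0, dx0.symm,
        dx1, dx1.symm]
  · intro i hi j hj
    simp only [List.length_cons, List.length_nil] at hi hj
    interval_cases i <;> interval_cases j <;>
      simp [nth_zero, nth_succ, h01, h01.symm, h12, h12.symm, h23, h23.symm, h34, h34.symm, h40,
        h40.symm, hx2, hx2.symm, hx4, hx4.symm, n02, n13, n24, n30, n41, n0x, n1x, n3x,
        G.adj_comm a2 a0, G.adj_comm a3 a1, G.adj_comm a4 a2, G.adj_comm a0 a3, G.adj_comm a1 a4,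
        G.adj_comm x a0, G.adj_comm x a1, G.adj_comm x a3] <;> decide

theorem common_unique {V : Type} {G : SimpleGraph V} (ht : TF G)
    (hr : Refuted G [18, 5, 42, 20, 41, 20]) {c : Fin 5 → V}
    (hc : ∀ i : Fin 5, G.Adj (c i) (c (i + 1))) (i : Fin 5) :
    {x : V | G.Adj (c i) x ∧ G.Adj (c (i + 2)) x} = {c (i + 1)} := by
  have e : ∀ k l : Fin 5, k + 1 = l → G.Adj (c k) (c l) := fun k l h => h ▸ hc k
  have f : ∀ i : Fin 5, i + 3 + 1 = i + 4 ∧ i + 4 + 1 = i ∧ i + 1 + 1 = i + 2 ∧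
    i + 2 + 1 = i + 3 := by decide
  obtain ⟨f1, f2, f3, f4⟩ := f i
  ext x
  simp only [Set.mem_ofPred_eq, Set.mem_singleton_iff]
  constructor
  · rintro ⟨hx1, hx2⟩
    by_contra hne
    exact root_false ht hr (e _ _ f1) (e _ _ f2) (hc i) (e _ _ f3) (e _ _ f4) hx1 hx2 hne
  · rintro rfl
    exact ⟨hc i, (e _ _ f3).symm⟩

/-! ### The certificates -/

def certs0 : List Cert := [
.scheme [72, 388, 82, 401, 44, 400, 261, 42, 106] [292084327424, 1408799941120, 586533626624,
    336619184896, 558372300544, 1932786737664, 558372300800] 82 44 385 [(2, 2, 2), (18, 1, 1),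
    (10, 2, 2), (32, 2, 2), (34, 2, 2), (42, 2, 2), (64, 2, 2), (66, 2, 2), (82, 2, 2), (72, 2,
    2), (74, 2, 2), (96, 2, 2), (98, 2, 2), (104, 2, 2), (106, 2, 2), (17, 1, 1), (5, 0, 0),
    (19, 1, 1), (257, 0, 0), (273, 1, 1), (261, 0, 0), (37, 0, 0), (129, 0, 0), (145, 1, 1),
    (133, 0, 0), (385, 0, 0), (401, 1, 1), (389, 0, 0)] [1119193456896, 1669207991296,
    1119453447680, 861753623040, 561106429952, 1932786747648, 586617513216, 561106429696] [],
.crit [28, 1308, 579, 2211, 163, 856, 3108, 792, 2210, 3236, 578, 840] [3300693164545,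
    3301229028097, 3300189283073] [(0, 0, [2])] 1 1 [],
.scheme [450, 45, 386, 82, 392, 322, 41, 21, 53] [1127714169090, 1127739310338, 1127697916162,
    45956964878593, 19302724740353, 45956964884993, 19302724675841, 19311306221825] 82 392 37
    [(16, 1, 1), (8, 0, 0), (2, 2, 2), (18, 1, 1), (17, 1, 1), (9, 0, 0), (256, 2, 2), (264, 0,
    0), (258, 2, 2), (128, 0, 0), (136, 0, 0), (384, 2, 2), (392, 0, 2), (386, 2, 2), (20, 1,
    1), (12, 0, 0), (5, 0, 0), (21, 1, 1), (48, 1, 1), (40, 0, 0), (33, 0, 0), (41, 0, 0), (168,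
    0, 0), (36, 1, 1), (52, 1, 1), (44, 0, 0), (37, 0, 0), (53, 1, 1), (45, 0, 0), (64, 1, 1),
    (80, 1, 1), (66, 2, 2), (82, 1, 1), (322, 2, 2), (194, 2, 2), (448, 2, 2), (450, 2, 2), (84,
    1, 1)] [2235883111170, 303149671426, 1127781253378, 1170731220994, 1651768313858,
    1926645981442, 1961005204226, 861493282562, 835725615618, 1677539206146, 560846652162,
    1128041326082, 334828211800577] [1127967187202, 49299235514365060096],
.scheme [42, 197, 26, 645, 676, 273, 2, 282, 160, 24] [1144081170435, 277329560835,
    1377126072579, 2244414357507, 27465418499, 1659233976835, 2261912666883, 1118922916099,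
    1377134199043, 2242260583427, 1660609914627, 45652714499, 1660299853827, 826329335043,
    2261853978883, 1660568012547, 2059180496136450, 856047154136832, 1990124662721026,
    855505988257536] 672 325 26 [(2, 1, 1), (34, 1, 1), (18, 0, 0), (272, 0, 0), (321, 2, 2),
    (337, 0, 0), (577, 2, 2), (705, 2, 2), (833, 2, 2), (676, 2, 2), (325, 2, 2), (580, 2, 2),
    (581, 2, 2), (709, 2, 2), (836, 2, 2), (837, 2, 2), (10, 1, 1), (42, 1, 1), (26, 1, 1),
    (282, 0, 0)] [1145498263555, 2262189523203, 45988258819, 1411786236419, 277915698435,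
    2502708961283, 2052582857026048] [],
.crit [28, 92, 291, 259, 131, 132, 2, 304, 140] [1960971886852, 1660275433988, 1394036728068,
    590722287601923, 2296082841469441, 82491471907529728] [(0, 0, [2])] 1 1 [],
.crit [6, 57, 49, 770, 774, 582, 416, 1600, 88, 184, 128] [1695170978053, 893933938181,
    1976499266821, 2250657580805, 1168324748805, 3060761127173, 1176914970373, 2811887659269,
    1720765924357, 1720765915909] [(0, 4, [24, 40])] 1 3 [2, 5, 4, 9, 8, 6, 7, 10],
.crit [14, 785, 801, 529, 42, 148, 128, 608, 6, 142] [1393264189446, 861159638278,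
    1109771503878, 1969251763206, 1145148080646, 310907585798, 1144695080710, 318335795413505,
    2878566808167169, 1811635914626042368] [(0, 12, [272])] 8 2 [3, 9, 1, 4, 5, 7, 6],
.scheme [392, 60, 450, 67, 258, 386, 12, 37, 53] [1676180004871, 1925229126407, 28219842823,
    1676959359239, 1108161929735, 1668896827399, 28228223239, 310388739081986, 310388739074050,
    362607715353092, 608639883421958, 336219437597188, 608648464967942, 644366167237638,
    642449866015750, 362581945550084, 2587177208841986, 19195574704473344] 65 60 386 [(136, 0,
    0), (130, 1, 1), (384, 0, 0), (392, 0, 0), (386, 1, 1), (17, 2, 2), (20, 2, 2), (21, 2, 2),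
    (65, 2, 2), (66, 1, 1), (67, 1, 1), (450, 1, 1), (81, 2, 2), (48, 2, 2), (49, 2, 2), (52, 2,
    2), (53, 2, 2), (60, 2, 2), (112, 2, 2), (113, 2, 2)] [303149670407, 1669207205639,
    71479640583, 28530213127, 835985663239, 1170991800327, 600936791959812] [],
.crit [28, 284, 99, 131, 67, 132, 148, 360, 130] [2210030723592, 1394053251336, 1153509951240,
    1733141469594117, 10207317508864, 599518112172295] [(0, 0, [2])] 1 1 [],
.crit [100, 100, 11, 52, 200, 139, 19, 48] [881870083719428, 2007227489624576, 10739600614913,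
    1426901416568840, 906290765235462] [(0, 0, [2])] 1 1 []]

def certs1 : List Cert := [
.scheme [66, 149, 266, 196, 98, 400, 281, 42, 100] [10000081418, 52941103882, 2218620150026,
    843189395722, 10780223242, 1952332187146, 53461198858, 576901424650, 2218652655882,
    44566778489088, 44841346058496, 19250909839360, 36019208734464, 35785938331648,
    26715302952960, 28647978215680, 834869192960, 19250908793088, 601598789888] 266 149 96 [(17,
    2, 2), (129, 0, 0), (257, 2, 2), (384, 2, 2), (385, 2, 2), (32, 1, 1), (34, 1, 1), (36, 0,
    0), (40, 1, 1), (96, 0, 0)] [1677797402378, 621236249866, 1110862266890, 560847168522,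
    311998350858, 294819244042] [],
.crit [82, 549, 266, 532, 297, 146, 641, 352, 148, 74] [560276258827, 10536960523,
    1410435990283, 843734663435, 560016213259, 1649830872075, 860923183115, 2751221531659,
    904149419531, 1650090918155, 2218929496331, 44814764157441, 584427833857, 37109870414337,
    10488345848321] [(1, 512, []), (3, 0, [64]), (5, 128, []), (2, 0, [128]), (4, 256, []), (0,
    64, [])] 6 7 [8, 9],
.crit [42, 81, 2376, 517, 1154, 577, 1062, 2320, 644, 1320, 2640, 1156] [603208122636,
    576609157132, 1994258219532, 2800346038796, 1668429382412, 2826189727756, 2542942388748,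
    1994560211212, 2219435402764, 2559809481740, 603210386444, 603277493516, 2559901756172,
    1992891662860, 3043295069708, 1452329241100, 2826357500940, 2279589112332] [(1, 80, []), (0,
    40, [])] 10 6 [5, 9, 3, 4, 2, 8, 7, 11],
.crit [12, 140, 83, 515, 1572, 400, 1156, 610, 1056, 152, 336] [1411703644685, 335100839181,
    903571923981, 3101254263821, 2536262690317, 1976491379469, 94027631325244031744] [(0, 0,
    [2])] 1 1 [],
.crit [26, 261, 522, 165, 321, 776, 144, 328, 178, 36] [1401803849742, 1995297603854,
    276548633358, 1102214128398, 827135673358, 2243667444494, 2792275109902, 2519569065998,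
    1102256030478, 1952415252494, 2209308549646, 277337686798, 2793398092558, 2519594207246,
    1951073116686, 1443729818638, 1444803526926, 52837829863940, 79483228719620, 61875490671108,
    44050050222596, 44050051245060, 2225080674820, 36560918047236, 1199672801372686848,
    642115109304437248] [(4, 0, [128]), (2, 0, [32]), (1, 256, []), (0, 0, []), (3, 160, [])] 5
    8 [7, 9, 6],
.crit [72, 328, 136, 23, 168, 336, 163, 84, 34] [2210030174991, 612301579791, 1411165471503,
    10747621179909, 607832397103364, 82764639637136384, 19494626298716163] [(0, 0, [2])] 1 1 [],
.crit [80, 80, 144, 96, 39, 152, 139, 100] [2199871038480, 2199619642896, 17653432109062,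
    26432898631686, 2315048878342400, 2296898900459776, 590506507419909] [(0, 0, [2])] 1 1 [],
.crit [42, 133, 82, 145, 268, 321, 164, 330, 176] [1118035583249, 10772619793, 1126934323217,
    585459639057, 560536035345, 1666474648593, 860386304529, 602102899985, 1168501187857,
    9406834051328, 61874374723840, 63230526138624, 61900429723904] [(3, 144, []), (2, 80, []),
    (0, 32, []), (1, 128, [])] 6 7 [5, 8, 4],
.crit [98, 21, 138, 116, 522, 137, 265, 292, 704, 272] [277084980498, 560544956434,
    1651164397842, 1402382664722, 1127227672082, 1968178806802, 294256984850, 1376839614738,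
    609938130962, 10797007378, 1176873289746, 44006823963137, 2243609291272, 53077249640968,
    8831342519809] [(5, 128, []), (2, 0, [256]), (3, 64, []), (1, 0, [640]), (4, 0, [256]), (0,
    64, [])] 6 8 [7, 9],
.crit [134, 49, 521, 100, 322, 394, 152, 609, 560, 388] [842897637395, 551401373971,
    320261931795, 62311450131, 1677260309011, 878656701459, 61616416115202, 44317083994626] [(0,
    132, [528]), (1, 48, [260])] 8 9 [5, 7, 4, 2, 3, 6]]

def certs2 : List Cert := [
.crit [12, 268, 131, 99, 320, 392, 152, 100, 50] [2475025539860, 611027068180, 1967170816020,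
    612067255828, 843703428611, 82262754186249985, 72384999983155456] [(0, 0, [2])] 1 1 [],
.crit [194, 49, 1376, 1424, 2058, 2054, 517, 521, 2060, 3264, 524, 816] [602159808533,
    593544446229, 895820857877, 620951077653, 913529471509, 636823111957, 2560113082901,
    3092429505045, 1392670673941, 2568399383573] [(1, 48, []), (0, 192, [])] 11 9 [7, 5, 6, 4,
    2, 3, 8, 10],
.crit [282, 161, 296, 69, 545, 1046, 136, 1090, 517, 1296, 672] [594374910230, 2542931894806,
    620363866134, 277638375446, 1144099267094, 594408449046, 1393498874646, 11091404566,
    844775900438, 277386674966, 3059654598678, 2508823289878, 2544257819158, 11090316054,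
    1410387238934, 11090355478, 827143282966, 594377271830, 277638335254, 594374896406,
    1168844303109, 8839616070405, 19646965014572877568] [(2, 288, []), (3, 64, []), (0, 256,
    []), (1, 32, [1088]), (4, 544, [])] 9 10 [5, 8, 6, 7],
.crit [12, 524, 35, 83, 168, 340, 552, 272, 672, 322] [1961189753623, 352272574487,
    294793577751, 294777324823, 861477094679, 18967465083910, 2550878277256194, 10196791903245,
    2387253643474141952] [(0, 0, [2])] 1 1 [],
.crit [14, 769, 641, 417, 1120, 536, 16, 1036, 1034, 1062, 912] [1401862504472, 1950260225304,
    2010138330136, 1145415992088, 2225406567704, 2285016237080, 3085433113112, 1144357480728,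
    1144617789720, 1686648990232] [(0, 6, [384])] 8 1 [2, 9, 10, 7, 3, 5, 4, 6],
.crit [12, 268, 147, 99, 100, 280, 536, 260, 162, 64] [1411433947673, 2528125428505,
    1686311854617, 302611768857, 586616210713, 826841049625, 826581002777, 18692587169288,
    9921913988623, 74116171889157633, 910011109596530432] [(0, 0, [2])] 1 1 [],
.scheme [164, 20, 75, 276, 170, 273, 260, 17, 104] [2242260049946, 310915441946, 1376814678554,
    2224852116506, 1376830931482, 1110299451930, 1376856580634, 1926570492442, 1926612394522,
    17601926047497, 44015690991881, 62156811034896, 26423186466576, 44564641767696,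
    52854430672656, 62672743981321, 8831016937744, 62156810774800, 2253769358729477,
    83371336793612544, 73826450851014402] 75 164 272 [(10, 2, 2), (170, 2, 2), (256, 0, 0),
    (257, 1, 1), (272, 1, 1), (260, 0, 0), (72, 1, 1), (104, 2, 2), (224, 2, 2), (200, 2, 2),
    (98, 2, 2), (74, 2, 2), (194, 2, 2)] [19680789274, 45710362650, 294558949402, 552516781338,
    560846922778, 62327703834] [],
.crit [516, 772, 43, 84, 392, 452, 40, 48, 50, 3] [1127967105563, 1958791955227, 343682114587,
    1694642554907, 344454939931, 36070563530250] [(0, 0, [2])] 1 1 [],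
.crit [4, 4, 43, 148, 328, 196, 560, 808, 144, 192] [1683914310428, 1127967105564,
    1151338366236, 577994048540, 2534317048604, 2259439666460, 1694902264348] [(0, 0, [2])] 1 1
    [],
.crit [6, 57, 625, 2, 134, 262, 260, 784, 224, 132] [1993679127837, 1961190801949,
    2244658405917, 2259967099933, 2253248340509, 2004140474909, 2491896907037, 1667262923805,
    2244658356509] [(0, 4, [56, 104, 88, 552, 536, 584])] 3 1 [2, 4, 5, 6, 8, 7, 9]]

def certs3 : List Cert := [
.crit [524, 524, 99, 51, 328, 396, 148, 96, 48, 3] [1153736909342, 1975980737566, 2233670125086,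
    293200545054, 2244658864670, 1969780433694] [(0, 0, [2])] 1 1 [],
.crit [14, 1105, 1313, 273, 138, 196, 546, 1072, 524, 1344, 646] [328583701791, 593790068255,
    1428884586783, 1436692079647, 1161327897119, 2526573847839] [(0, 6, [272])] 4 1 [2, 10, 7,
    5, 6, 9, 8, 3],
.crit [38, 265, 577, 18, 776, 897, 388, 96, 114, 52] [1667262398496, 603989510176,
    2491418494496, 18322638368, 1976834277920, 1978134775840, 1168769893664, 1967909322784,
    29337488707299844, 53387871652111, 80857593874198, 1523404750616264960] [(0, 36, [520]), (1,
    0, [16])] 9 4 [2, 5, 8, 6, 7, 3],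
.crit [12, 524, 99, 19, 104, 788, 404, 1088, 1120, 1058, 896] [3025587675681, 352280708385,
    1142553921825, 862005560865, 352281496097, 861737149985, 862013957409, 27488420144656] [(0,
    0, [2])] 1 1 [],
.crit [14, 1217, 81, 1169, 268, 896, 518, 42, 1072, 1120, 778] [2517950097186, 1437474521890,
    1444737279010, 336150750498, 1126901835554, 886451561762, 1170120993314] [(0, 10, [80])] 4 3
    [1, 7, 10, 8, 5, 9, 6, 2],
.crit [28, 540, 387, 67, 35, 400, 520, 548, 36, 194] [1410385657891, 1942962126883,
    310934045987, 10188738848793, 11049286872678402, 1811379445769496577, 641800650809156352]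
    [(0, 0, [2])] 1 1 [],
.crit [38, 145, 73, 52, 266, 393, 4, 34, 48] [1109730336804, 551938760996, 310866420516,
    2243600654372, 1127236026916, 1968723534628, 1933299491876, 277101724196, 860679627044,
    35529387935507, 318692165907, 44007327541523, 70687673026330, 62956706752531,
    62715383277594, 635819711063049, 70687671191834, 626997874196745, 62715381442842,
    65346451039373575, 64187315627772166, 54959957379926280, 54107010455324936,
    56356886919792901, 20294270574659328, 19986382354409472, 915936723150595, 27083488831285251]
    [(3, 48, [448]), (0, 32, [448]), (2, 64, []), (1, 144, [])] 7 5 [6, 4, 8],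
.crit [80, 212, 10, 52, 11, 200, 35, 34] [61891336503828, 27780185114388, 1990126028743680,
    19825889174282, 63823516812554, 45958306759184, 26974551852816, 1699613083976467] [(0, 0,
    [2])] 1 1 [],
.crit [24, 280, 200, 39, 67, 72, 52, 260, 130] [1943741440806, 1153258299942, 2210029675302,
    19018149030144, 44581794375936, 10472206386460] [(0, 0, [2])] 1 1 [],
.crit [36, 36, 27, 196, 68, 67, 56, 8] [2200928526887, 27539372525569, 45630336820246,
    36060587640833, 10463884633117, 2042078188037120] [(0, 0, [2])] 1 1 []]

def certs4 : List Cert := [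
.crit [40, 40, 48, 19, 76, 71, 48] [62431914378752, 27489191872023, 53360699156226,
    19275838695170, 9939361482270] [(0, 0, [2])] 1 1 [],
.crit [28, 156, 323, 35, 291, 216, 548, 34, 532, 1344, 2560, 1024] [2545843184681,
    1411509749801, 1935958147625, 604576441641, 1669233401897, 1428967918633, 604349949225,
    620130241536] [(0, 0, [2])] 1 1 [],
.crit [28, 28, 1027, 1283, 291, 1552, 640, 64, 536, 352, 44] [2545576059690, 1410721398826,
    2776236124202, 1410452963370, 895283980586, 2793660222250, 1169659554561,
    66376401326135312640] [(0, 0, [2])] 1 1 [],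
.crit [512, 656, 56, 196, 326, 452, 56, 42, 560, 259] [1108186785579, 335091909419,
    309322867243, 841897804843, 309322868267, 1935487321131, 335093450027, 2101017196804982272]
    [(0, 0, [2])] 1 1 [],
.scheme [98, 141, 50, 50, 204, 13, 273, 274, 192] [2534081586220, 2261569265964, 53974164524,
    53982544940, 2261585518892, 2261593899308, 1161253890307, 292109453571, 593830349059,
    1960729658115, 1683637985795, 1152940771587, 300699388163, 1178433758467, 74028478337173760]
    141 274 96 [(16, 0, 0), (64, 1, 1), (192, 1, 1), (2, 0, 0), (18, 0, 0), (272, 0, 0), (257,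
    2, 2), (258, 0, 0), (274, 2, 2), (132, 1, 1), (5, 2, 2), (261, 2, 2), (136, 1, 1), (9, 2,
    2), (265, 2, 2), (12, 1, 1), (140, 1, 1), (13, 1, 1), (32, 0, 0), (48, 0, 0), (34, 0, 0),
    (50, 0, 0), (288, 0, 0), (304, 0, 0), (290, 0, 0)] [54041265196, 11090855724, 1651769098540,
    1935496749100, 277378827820, 1652027843884, 1394071094316, 1402661028908, 1686387335724,
    628190087683] [],
.crit [6, 417, 169, 772, 576, 70, 432, 70, 74, 24] [576650037293, 2749652853037, 344747229997,
    842938008877, 842938009389, 2751221522989, 2815626521094144] [(0, 6, [48, 144])] 4 6 [7, 2,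
    1, 5, 8, 3, 9],
.crit [14, 417, 369, 401, 12, 6, 644, 74, 14, 64] [1126633654062, 1978370425390, 1117021095470,
    2785070326318, 1978370400814, 2785607197230, 1392435873326, 2526540023598, 2622955612013057]
    [(0, 0, [272, 48, 288])] 5 2 [4, 8, 1, 3, 7, 6, 9],
.crit [14, 1105, 1313, 1297, 522, 516, 386, 576, 588, 432, 14] [1659217207343, 619559347759,
    2511215345967, 1976784480303, 312234535215, 861193644806] [(0, 14, [48, 1184])] 5 2 [10, 1,
    3, 4, 8, 9, 6, 7],
.crit [6, 297, 417, 642, 64, 70, 432, 76, 70, 8] [301772392240, 2750684660016, 834348336432,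
    834348337200, 2751221530928, 611043320624, 594611284487, 2815626252928771, 620381088263,
    1426224900615, 1533274221991962624] [(0, 6, [48, 272])] 4 6 [8, 2, 1, 5, 7, 3, 9],
.crit [28, 156, 67, 35, 35, 216, 292, 34, 64] [2534618727729, 826027297032, 2332623876653572,
    72919647980398336, 72921322968327170, 72646969097725699] [(0, 0, [2])] 1 1 []]

def certs5 : List Cert := [
.crit [6, 25, 225, 98, 226, 28, 28, 20] [1142730541065, 1400697792521, 1151320475657,
    1959043278857, 2313391037514496, 2313398815064325] [(0, 6, [])] 4 1 [2, 7, 5, 3, 6],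
.crit [6, 153, 281, 550, 582, 72, 48, 514, 516, 408] [1686312378675, 1694105158451,
    1402844807731, 1428093748275, 1694381720371, 1934900937523, 1427817186355, 1934901199923,
    1402844799283, 1686312387123, 301772352010, 310085470730] [(0, 6, [384])] 8 2 [1, 4, 3, 9,
    7, 6, 5],
.crit [6, 561, 57, 260, 390, 326, 672, 1104, 56, 1090, 640] [1961459261748, 1710269752372,
    1695170978356, 2233476925236, 1976557724980, 2483365438516, 1109000800564] [(0, 2, [24,
    40])] 3 8 [1, 5, 4, 2, 9, 6, 7, 10],
.scheme [34, 533, 394, 564, 202, 265, 528, 20, 36, 74] [2750944452917, 44594447157,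
    1402902725685, 2483902300725, 1376287801653, 11342242357, 11333861941, 2217847374133,
    11325465653, 44847940405, 2218921107765, 2218963009845, 1943012721461, 1376034308405,
    1402894345269, 2501633967413, 575795145228, 843157875212, 71279848988674, 18769360192770,
    559194049036, 35820899966978, 35812326809602, 18769896579074, 2956896030824613632] 385 564
    74 [(32, 0, 0), (36, 0, 0), (17, 2, 2), (273, 2, 2), (513, 2, 2), (516, 0, 0), (528, 0, 0),
    (532, 0, 0), (769, 2, 2), (200, 1, 1), (194, 1, 1), (202, 1, 1), (448, 1, 1), (449, 1, 1),
    (456, 1, 1), (450, 1, 1)] [11627448629, 1445577189941, 277655389493, 45986906933,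
    1403196326965, 1403196328245, 1377426768181] [],
.crit [28, 92, 291, 3, 387, 132, 258, 48, 84] [1436935324726, 1394036728118, 1960971886902,
    8865425958659, 8865962321155, 74618949609752320, 74618966806381824, 925557953201666] [(0, 0,
    [2])] 1 1 [],
.crit [28, 540, 99, 163, 3, 268, 388, 584, 96, 130] [1978370630199, 2244659127095,
    2751204991543, 1669207982391, 71005743113988, 594376944142, 1462960921510144] [(0, 0, [2])]
    1 1 [],
.crit [28, 92, 387, 3, 163, 784, 770, 532, 100, 224] [2536717165112, 1660543099960,
    1411484508472, 80352128550917, 1161052834319, 2043485872980225] [(0, 0, [2])] 1 1 [],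
.crit [388, 388, 27, 164, 68, 72, 176, 75, 3] [1153467950905, 1402576314937, 1951560648976,
    882135348805890, 45982726767622, 82509029751652609, 46190811847065856] [(0, 0, [2])] 1 1 [],
.crit [12, 140, 83, 99, 36, 24, 140, 66] [1410897068602, 8848505611271, 8848237430023,
    1402365552145, 1118897710609, 1998157299328512, 1989086597096960, 46214712705283] [(0, 0,
    [2])] 1 1 [],
.crit [24, 280, 88, 39, 135, 392, 388, 112, 98] [2210030961723, 2475529872187, 79226343276800,
    8814422975752, 1118614087954] [(0, 0, [2])] 1 1 []]

def certs6 : List Cert := [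
.crit [24, 280, 152, 71, 39, 336, 168, 68, 34] [1694633313340, 2210030699324, 2475798307900,
    79217745215745, 8814154794249, 843468015891] [(0, 0, [2])] 1 1 [],
.crit [24, 24, 72, 39, 99, 152, 148, 96] [603443209277, 2200944780093, 1144090552340,
    70420855038210, 8840184381962, 2041295975522560, 1990168424784129] [(0, 0, [2])] 1 1 [],
.crit [36, 36, 75, 20, 40, 83, 36] [1127160791614, 62673522533888, 62397864748544,
    61599512838403, 8849034085131, 8848229557259] [(0, 0, [2])] 1 1 [],
.scheme [22, 97, 73, 52, 137, 138, 134, 112] [9957853184, 576876218368, 318651295744,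
    9153587222, 17491847190, 550604122134, 328330135552, 327786711062, 860345862166,
    36289669120, 859003217920, 326451652630, 1435593132032, 276547799062, 18313168918,
    1436147288064] 22 137 96 [(2, 2, 2), (1, 0, 0), (4, 1, 1), (8, 2, 2), (32, 0, 0), (64, 0,
    0), (16, 1, 1), (128, 2, 2)] [1101735969087, 577748919615, 1402382369343, 1385203007551,
    320051118911, 844296939071, 277361779775, 36844128063] [],
.crit [74, 261, 50, 145, 1292, 1092, 289, 1544, 82, 128, 176] [1126674292800, 1649839792960,
    825994862912, 11099218496, 1950462074944, 277353685824, 860646367808, 1170739340864,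
    53503157568, 586590282560, 28741551168, 345024324672, 2235859036736, 11065666368,
    10244606743] [(3, 144, []), (2, 48, []), (0, 64, [160]), (1, 256, [])] 10 5 [4, 8, 6, 7, 9],
.scheme [592, 388, 74, 52, 393, 200, 37, 50, 530, 257] [1099798234689, 51867632961,
    603210465345, 1400494965825, 34906392385, 1437002711361, 53696348737, 34646344513,
    1668932256065, 1652020765761, 1651978863681, 1667849005592, 1959327500802, 1968169601560,
    1401770510872, 1401234672130, 1692763220504, 2396839150949803520] 712 293 18 [(129, 2, 2),
    (5, 0, 0), (514, 1, 1), (578, 1, 1), (385, 2, 2), (261, 0, 0)] [1428966940737,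
    1437556343105] [],
.scheme [148, 36, 267, 84, 41, 146, 392, 97, 68] [560016205122, 319463433282, 2484370997826,
    293988279106, 1101189685826, 318683293506, 293728231490, 1385420620354, 1125627266626,
    1385396240962, 1385463284290, 1100864047385, 859538762009, 1435618035993, 841873950979,
    1410678679833, 1100058257667, 83344390673449216] 266 97 148 [(10, 1, 1), (130, 1, 1), (64,
    0, 0), (96, 0, 0), (266, 1, 1), (386, 1, 1)] [1411509699394, 878934492994, 1128043185730]
    [],
.crit [42, 69, 50, 145, 12, 133, 130, 104] [860613837379, 1118620942659, 1658957660227,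
    585784951619, 275449669658, 292084287514, 826564421658, 559746697242, 43790387226,
    43520944132, 2279349093187584, 2315047511033088, 2262263755735040] [(2, 48, []), (1, 64,
    []), (0, 32, []), (3, 144, [])] 7 5 [6, 4],
.scheme [38, 145, 329, 52, 266, 73, 164, 322, 148] [1710235918660, 1976783938884, 2525710058052,
    277320630852, 1976783938116, 277362532932, 603182901509, 601305180443, 1666457602309,
    551426468123, 841823095045, 575535352091, 576607791365, 550595995931, 1993134328091] 10 180
    321 [(128, 2, 2), (1, 0, 0), (16, 2, 2), (144, 2, 2), (72, 1, 1), (160, 2, 2), (48, 2, 2),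
    (176, 2, 2), (320, 1, 1), (264, 1, 1), (328, 1, 1)] [11091380036, 337767867972, 11090592836,
    1935495700548, 311998063428] [],
.crit [14, 609, 353, 785, 40, 150, 6, 800, 140, 138] [860622767429, 1411435799365,
    1667548137541, 2218628564293, 1126902352197, 825752043804] [(0, 8, [320, 576])] 6 1 [3, 9,
    8, 2, 5, 7, 4]]

def certs7 : List Cert := [
.crit [14, 81, 225, 145, 298, 20, 262, 268, 208] [1144879104582, 1951535539270, 825749686557,
    825213593863, 11314268085158656, 29337462687400192] [(0, 10, [192])] 6 1 [3, 4, 8, 7, 2, 5],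
.crit [70, 25, 385, 1058, 1154, 584, 1185, 596, 516, 416, 88] [1959872520519, 1109494685767,
    11050509127, 53763466567, 835389579335, 1651508273479, 1160490608967, 551124296007,
    11067286599, 2802483290183, 312208860999, 1160538817095, 2534301853255, 550914844231,
    312267523911, 1651751545671, 1651180579614] [(2, 256, [528]), (0, 64, [288]), (1, 16, []),
    (3, 1056, [528])] 6 5 [10, 4, 7, 9, 8],
.scheme [82, 165, 330, 52, 521, 522, 5, 770, 132, 176] [577480246344, 36525392712, 860882550856,
    53486633544, 1128016446024, 1650116608328, 1128033206856, 1400211849800, 1101677281608,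
    1385211936840, 1102238507336, 844288311624, 1102255268168, 1668411335496, 36567337288,
    576599665161, 867852954121, 275441551903, 292896688649, 18470249463812, 868659505695,
    2002528807433, 618552911201283, 1516042152639496192] 165 338 520 [(129, 1, 1), (144, 2, 2),
    (264, 0, 0), (328, 0, 0), (160, 1, 1), (164, 1, 1), (776, 0, 0), (832, 0, 0)] [37396980552,
    11628783432, 862030446664, 37398292808] [],
.crit [6, 561, 169, 324, 258, 262, 1544, 1540, 568, 450, 2240, 1024] [575872271945,
    1678260347465, 1942467740489, 842160244553, 2801460151113, 877257394505, 2004718749769] [(0,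
    4, [24, 48])] 4 8 [2, 3, 5, 1, 9, 6, 7, 10, 11],
.crit [98, 141, 770, 530, 200, 1153, 785, 50, 68, 76, 32] [559471222858, 1436717769802,
    1375489057098, 11367686986, 1686353831754, 3025571751498, 1375230584394, 1652238868810,
    2501910782282, 1652247249226, 1161805521226, 1160270398794, 561073709130, 1959109158474,
    1161805515594, 1959109151562, 561073186634, 1161881011530, 1652045922634, 11368735306,
    1960115989259, 2216473209611, 93684725877933885440] [(3, 528, []), (2, 768, []), (1, 128,
    []), (0, 96, [])] 7 5 [4, 6, 8, 9, 10],
.scheme [76, 52, 771, 177, 74, 266, 17, 776, 164, 132] [1950462067787, 1686061269323,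
    311443931979, 1950202019915, 1110047801931, 1110853100107, 552483218251, 1650620449355,
    552499979083, 2749863371339, 1110861480523, 2244473783115, 1649579737931, 1402593689675,
    1651213943371, 827328635467, 1108639263244, 2216230201868, 825717443106, 1181494811034118,
    859278723596, 1443646752524, 578261623815, 2956930416325189632] 148 842 33 [(144, 1, 1),
    (160, 1, 1), (176, 1, 1), (514, 0, 0), (578, 0, 0), (768, 0, 0), (770, 0, 0), (832, 2, 2)]
    [20217635147, 28808652619, 20217915467] [],
.crit [4, 140, 771, 1106, 808, 208, 2088, 290, 148, 1044, 2568, 1088] [836447306316,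
    1932837045068, 1409037207884, 335109211468, 303938446412, 559724200780] [(0, 0, [2])] 1 1
    [],
.crit [1042, 133, 522, 84, 169, 1296, 776, 786, 224, 196, 33] [844019884365, 878901553229,
    36558168909, 1410435737421, 293435171661, 2536984323149, 1718617195853, 336644629581,
    1443202147917, 1128058397261, 2537008702541, 578480284749, 10000083789,
    92245315064173193984] [(2, 0, [64]), (1, 128, [1280]), (0, 0, [32])] 8 5 [6, 7, 4, 3, 9,
    10],
.scheme [324, 172, 531, 82, 12, 770, 137, 322, 161, 36] [877583220814, 1383030932302,
    833293206862, 860411216462, 2491938848846, 1118102437966, 1677227278670, 1935453266510,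
    1935495168590, 19923771726, 1127741210958, 2518008522830, 1127781295694, 2750667629134,
    2493288104270, 1118362222926, 1127739353678, 302258883087, 833762159119, 1383518497295,
    882427129511945, 2946209061489649920] 137 100 786 [(64, 0, 0), (256, 0, 0), (320, 0, 0),
    (592, 0, 0), (784, 1, 1), (40, 2, 2), (168, 2, 2)] [552533288526, 552533813326, 54576579406]
    [],
.crit [264, 392, 200, 39, 416, 88, 36, 22, 19] [1144877753167, 1666523866959, 868716431632,
    843190954278, 19567898559755, 56024535078822912, 74592527818712326, 83318251526874371] [(0,
    0, [2])] 1 1 []]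

def certs8 : List Cert := [
.crit [6, 305, 201, 52, 138, 74, 36, 276, 130] [2475554832720, 2476108202576, 1400428841255,
    859532175655, 868121848103, 1172354559928064, 1159911721255, 908472029840640] [(0, 6, [])] 7
    2 [1, 8, 4, 3, 5, 6],
.crit [70, 25, 41, 774, 898, 644, 513, 48, 24, 120] [1109462171729, 1651180912977,
    1651441484369, 1969267753553, 1651189301841, 2759055704913, 53722040657, 11335435345,
    1729328637009, 11343815761, 19413656913, 1110568602152, 303113980434, 2851326004561408,
    2859838898177536, 2859881302598410] [(1, 8, [384]), (2, 40, [384]), (0, 64, [])] 7 5 [6, 9,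
    3, 4, 8],
.crit [26, 69, 42, 773, 33, 596, 162, 832, 136, 168] [1410922266706, 1101441614162,
    2259162580562, 2501291098194, 1994223862610, 37063279954, 1101466780498, 327577569106,
    2225909088850, 1659233634857, 841847450153, 843189332499, 2895573285078017,
    2870026282730497, 2870034595865099] [(2, 32, [768, 320]), (1, 0, [128]), (3, 0, [128]), (0,
    16, [])] 7 8 [4, 5, 6, 9],
.crit [50, 133, 90, 388, 261, 321, 36, 10, 56] [1694105673811, 1428354269779, 275466201386,
    2254326613705475, 2542964270736898, 276270975252, 35754363178, 34948319508, 893941492010,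
    11602890121610496, 20610921292367105] [(0, 48, [384]), (1, 0, [8])] 8 3 [5, 4, 2, 6, 7],
.crit [136, 200, 40, 23, 72, 196, 50, 35] [1393717183316, 327240689707, 1752640081896452,
    2252952753185283, 2041286555895296, 335421645824527, 1970618304873485] [(0, 0, [2])] 1 1 [],
.crit [4, 644, 43, 532, 200, 196, 304, 50, 1600, 266, 256] [1128234525269, 335100560469,
    2277692760917, 353314105429, 844013331797, 1960728683349] [(0, 0, [2])] 1 1 [],
.crit [98, 261, 26, 292, 100, 25, 145, 832, 138, 128] [1994207609174, 869513117782, 11090559574,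
    894479714134, 1993955426646, 11065444438, 560276521046, 277353678422, 893405972310,
    344723900246, 11065395798, 277353368150, 2207655938583, 867592342039, 1409294584343,
    2668146968341539328] [(0, 96, []), (2, 24, []), (1, 256, [])] 8 3 [5, 4, 6, 7, 9],
.scheme [38, 137, 321, 322, 160, 81, 44, 274, 140] [1143275593815, 878086006103, 550889136471,
    619851360087, 1142755501655, 9740813143, 1144625897559, 1676169781591, 18313193559,
    276028785239, 1675306273048, 1374684727576, 18969016977410, 1425938082094, 62407502268674,
    1376025848110, 1667263105326, 72045123881218, 893890390296, 83071695749652480] 129 44 338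
    [(8, 0, 0), (4, 0, 0), (17, 1, 1), (80, 1, 1), (18, 1, 1), (272, 1, 1), (336, 1, 1), (160,
    2, 2)] [11091379031, 303408891479, 835984834647, 878933214551, 1377150230871, 277639397975,
    19940567127] [],
.crit [70, 1049, 41, 262, 162, 84, 161, 1104, 1544, 2304, 386, 512] [1110585213784,
    1144634049112, 577491011672, 551988330840, 1711880374872, 11108394072, 1978201817176,
    11645264984, 2760424046680, 3102930208856, 1145514779224, 1411971367256, 1394052793176,
    1652514963800, 1110619734104, 578556627032, 3334506103128, 11074898520, 54594193240,
    1411995746648, 1711880293464, 1975694437401, 1649570761753, 1960117021743, 35505480140308]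
    [(4, 160, []), (3, 0, [1536]), (0, 64, []), (1, 1024, []), (2, 32, [])] 10 7 [6, 5, 8, 9,
    11],
.crit [4, 324, 1027, 800, 448, 200, 50, 560, 1050, 1160, 772] [343691043673, 868129793625,
    326510634329, 1400781236313, 893447103577, 1403197073497, 1160262805849, 2233476654937,
    104340040249620628480] [(0, 0, [2])] 1 1 []]

def certs9 : List Cert := [
.scheme [198, 41, 521, 22, 104, 274, 273, 769, 224, 132] [1686060221274, 320303876186,
    2758494928986, 1385716007002, 54040241242, 11090855258, 835699949658, 1153794588762,
    276037707610, 1153752686682, 2260310704218, 843241283674, 577490166874, 1443998279514,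
    2244473520474, 1385682231386, 1993486640474, 1650694365786, 1127512875610, 860604377627,
    1151061002779, 834349042225, 276522879515, 1719337544219, 8841754362902, 603519778034084352]
    785 168 70 [(16, 1, 1), (32, 2, 2), (130, 0, 0), (192, 0, 0), (520, 2, 2), (513, 1, 1),
    (768, 1, 1), (6, 0, 0), (68, 0, 0), (132, 0, 0), (134, 0, 0), (196, 0, 0)] [1445885716314,
    578303861850, 11367679322, 1128318181978, 1686664135514, 1154088231002, 320865888346] [],
.scheme [266, 149, 98, 97, 34, 28, 268, 258, 193] [1668896842075, 827108917595, 2491887444315,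
    1668864336219, 1994014869083, 1144415896411, 2260034158939, 1410435440987, 1400168302876,
    824920574236, 1392376293682, 558372260124, 70347188508, 592974997810, 35744353659142,
    26433696047639, 17921063518999, 71194737166598, 82507929753485568] 266 224 21 [(8, 1, 1),
    (32, 2, 2), (2, 1, 1), (64, 2, 2), (96, 2, 2), (20, 0, 0), (17, 0, 0), (132, 0, 0), (129, 0,
    0), (148, 0, 0), (145, 0, 0), (256, 1, 1), (264, 1, 1)] [1144961155931, 1402659471451,
    28270167387, 2253063987803, 827134083419, 294818481755, 604055332955] [],
.crit [4, 132, 43, 148, 584, 196, 304, 298, 704, 1296, 512] [1128235541084, 335102134364,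
    3051911128924, 2545616168796, 1695170699868, 1992958232924, 2261930492764, 1968739994397]
    [(0, 0, [2])] 1 1 [],
.crit [28, 156, 35, 3, 259, 772, 512, 770, 176, 224] [2235078041693, 293746066781, 335092697437,
    1394313552221, 1393264975965, 294005279240, 1812428405874911744] [(0, 0, [2])] 1 1 [],
.crit [14, 8737, 9345, 1553, 2184, 2, 2304, 4116, 9792, 266, 2316, 5200, 2176, 262]
    [1942676684894, 611345851486, 1127010017374, 1126959532382, 3591434782558, 3850205995870,
    1126959794782, 1126632636510, 860453701470] [(0, 14, [])] 9 3 [1, 2, 13, 10, 8, 4, 11, 7,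
    12, 6, 5],
.crit [138, 261, 26, 1093, 1060, 2064, 4616, 1537, 2, 2240, 2200, 5664, 2112] [1676413346399,
    1676490317919, 1925238071647, 2536187469919, 2003712181855, 877609724255, 1727734589279,
    3113062810463, 2774928819807, 276038002527, 3575881679711, 28279155295, 60777130335,
    1726957005663, 2013375538271, 1927417537375, 1676473641567, 1410906038879, 2535407234399,
    914125794143, 1678562388575, 914067131231, 22535698463510095470592] [(0, 136, []), (1, 256,
    []), (2, 24, [])] 10 7 [3, 4, 8, 5, 11, 9, 6, 12],
.crit [6, 97, 1065, 276, 104, 150, 2066, 800, 1160, 1152, 772, 64] [1970317116000,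
    1685573960544, 893666035552, 1658681394528, 1142564136800, 861468460384, 3335101105504,
    861512935008, 861781370464, 1394625030752, 2749216509969354245120] [(0, 6, [72])] 6 1 [2, 5,
    4, 3, 11, 7, 8, 10, 9],
.crit [6, 801, 385, 1296, 552, 82, 416, 2116, 78, 1042, 2568, 5248, 2048] [896844243297,
    346635215713, 1127211182177, 2775942015073, 860923209057, 3111713352033, 1709508758369,
    1692327027809, 1142572508769, 3393368992353, 1128613292129] [(0, 6, [160])] 5 1 [2, 8, 6, 7,
    11, 3, 4, 10, 9, 12],
.scheme [290, 2073, 56, 198, 518, 69, 296, 2056, 1089, 3088, 768, 642] [835976527970,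
    45400031842, 11350410338, 2199596663138, 1110301311842, 11870454626, 595668861026,
    586089597282, 277379385442, 44855034466, 11862074210, 277663499618, 2509896778082,
    2510166524514, 2817793558114, 1394354742114, 1394329578594, 1678350778722, 1377645191522,
    1110082650210, 1376361991266, 595457310818, 275517098082, 1118671258978, 1426742905891,
    599580706087686, 3636368830483374302976] 3128 705 262 [(32, 1, 1), (1216, 2, 2), (644, 0,
    0), (3073, 2, 2), (3088, 2, 2)] [278468805986, 1111693262946, 1395160065122, 46541070946,
    304239412834] [],
.crit [6, 25, 81, 290, 166, 600, 36, 1296, 648, 1312, 640] [1994517734243, 835967345763,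
    1159734306915, 1408843728739, 311462290787, 834852971619, 1142555756899, 1961509070179,
    302352509027, 855508975912199, 104143551190434858498, 21620148280635459328] [(0, 6, [72])] 6
    2 [1, 4, 5, 3, 8, 9, 7, 10]]

def certs10 : List Cert := [
.scheme [2578, 1065, 56, 134, 69, 70, 560, 1288, 2688, 321, 2178, 1281] [10796761956,
    1949950116452, 844768052324, 1385203597412, 2759835878756, 577944256868, 886452357220,
    276825737572, 320051709540, 3025310417252, 3326721999204, 2757941887076, 578011367268,
    10570220900, 1951567806820, 586338893924, 277126628452, 276824640612, 10796715108,
    1102817567076, 836521517156, 836538277988, 10838656356, 276858192996, 10301793124,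
    275517589860, 842887638053, 1152401878053, 950581800730888, 833795394619, 593780812859,
    590518325093640] 2694 1080 321 [(132, 1, 1), (320, 0, 0), (1056, 0, 0), (1288, 0, 0), (2064,
    2, 2), (2688, 2, 2)] [888095991908, 37950890596, 12180841316, 845403964516, 12180833636,
    579118122852] [],
.crit [6, 6161, 2113, 5408, 162, 2136, 1060, 4368, 648, 9472, 584, 38, 138, 512] [1400278689893,
    931472171365, 1694423696485, 1142580921189, 2228644529509, 2777512004709, 1144961746533,
    1959093192037, 870117288805, 3651310307941, 1403768286309] [(0, 6, [80])] 4 1 [2, 11, 5, 6,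
    10, 3, 12, 7, 8, 9, 13],
.crit [4134, 2321, 73, 276, 138, 577, 292, 2064, 74, 5152, 512, 4226, 2561] [3299635470950,
    19094676326, 2519007338598, 277639439718, 11385201766, 1375264940390, 1428891215974,
    2252551038310, 1693302497382, 1377914937702, 2518841050726, 11384940646, 578050909286,
    1719899627878, 3127651944806, 2210131716966, 19975406438, 277672911462, 1668964261990,
    3033070411878, 552518659174, 277404476006, 2252534263142, 3618518958182, 3300213760358,
    276867605094, 551729605734, 2828059913318, 2577626622822, 95078060248391980182784] [(1,
    2304, []), (4, 128, [2304]), (3, 256, []), (5, 576, []), (0, 4096, []), (2, 64, [])] 11 12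
    [7, 9, 6, 8, 10],
.crit [8198, 81, 137, 2308, 546, 5136, 642, 2116, 5128, 3152, 800, 4744, 2336, 1]
    [3100976202855, 1409287831911, 3127040918887, 2226462507623, 1658682982503, 2826098820711,
    2568409432935, 1110000910439, 1977950929255, 2826653780839, 1460610648423, 3393042630503,
    2568509262951, 3341495420007, 3342409671783, 2225063445095, 2020867164519, 1712887546471,
    2563410782311, 2826684450407, 3393343571815, 893473040999, 1979175780711, 3130344424807]
    [(3, 2304, []), (0, 8192, []), (2, 128, []), (5, 5120, []), (4, 512, []), (1, 64, [])] 6 7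
    [9, 11, 12, 10, 8, 13],
.crit [6, 2177, 4353, 2256, 4392, 1552, 1544, 266, 148, 4192, 2144, 1034, 532] [1125392926312,
    1675641595752, 1409077061736, 654740661352, 2525802636136, 859104953704, 1142823692904,
    1412332839784, 2517455709288, 653692086632, 3678129161320, 3333257012072,
    124295920578166266535936] [(0, 6, [])] 11 1 [2, 3, 7, 8, 4, 12, 9, 5, 6, 10],
.crit [2052, 2084, 387, 1552, 168, 82, 2208, 596, 516, 392, 8, 67] [1386202595945, 859540391273,
    859280344937, 317930103913, 1408852632425, 295330457449, 2276434461545, 320537169001,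
    2733027836705231095554, 38436051843086838272] [(0, 0, [2])] 1 1 [],
.crit [6, 193, 1161, 532, 232, 3344, 2066, 22, 4640, 1288, 548, 4192, 2304] [1463780401770,
    1142572812394, 1685850792810, 859105224042, 3635732595818, 1944322419306, 1412080084842,
    862307329642, 337449952362, 2036510301606448134] [(0, 6, [72])] 6 1 [2, 7, 4, 3, 9, 10, 5,
    8, 11, 12],
.scheme [1186, 21, 202, 52, 522, 777, 2052, 2053, 1056, 48, 2305, 1216] [1666490401643,
    3084870058091, 2751229165931, 578822407531, 278167102827, 276582992491, 578212431211,
    612345938027, 3359747948651, 61230121579, 1943515792235, 10302071915, 1667790635371,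
    1126992774507, 2286098893675, 1127514688619, 11595230315, 3085154222699, 2243056992363,
    1403432739435, 276582968427, 1668896883051, 3360032080491, 11593941611, 1127531463275,
    1668896853099, 1110334819435, 11593919595, 3616465156011725514240] 176 2309 1610 [(2048, 2,
    2), (328, 0, 0), (16, 2, 2), (1216, 1, 1), (1090, 0, 0), (2816, 0, 0), (840, 0, 0)]
    [1377720369515, 2288254765931, 1944916886379, 845404006251, 12181120107, 2019786075243] [],
.crit [20, 116, 515, 800, 1027, 1162, 770, 288, 200, 76, 48] [317922280300, 326510635116,
    870587072876, 2225341031788, 561358128492, 561383269740, 53123185681192,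
    76996364502501189378, 1218807310124892416, 39793905565811384583] [(0, 0, [2])] 1 1 [],
.crit [528, 592, 280, 196, 39, 208, 42, 296, 132, 3] [844498248813, 326501983085, 327509371460,
    1693041068612, 71212211431960, 886139587118, 2938389042221582592, 2369758213965883657] [(0,
    0, [2])] 1 1 []]

def certs11 : List Cert := [
.crit [12, 588, 147, 35, 292, 88, 290, 516, 1104, 130, 256] [1660811272814, 1942174655598,
    2482585511534, 328389970030, 2236336104046, 294810641518, 586893780334, 1411223997294,
    101384601977489152, 293711407897] [(0, 0, [2])] 1 1 [],
.crit [4100, 4868, 27, 100, 580, 776, 152, 3136, 1058, 50, 4480, 128, 1027] [1403649294959,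
    293988574063, 1675148469615, 1453628957807, 2211103670895, 3385561294703, 3385292859247,
    1402903465327] [(0, 0, [2])] 1 1 [],
.scheme [266, 37, 82, 1553, 2092, 530, 2180, 320, 641, 296, 2056, 1104] [1667254026608,
    3060240057712, 1384926511216, 276549699696, 2774861449584, 1410899477360, 294501844080,
    587420738416, 3315741320304, 294836340336, 587339219824, 2845475178096, 319774624112,
    10570769776, 860923200112, 2201808839024, 276549684336, 1454735721328, 2775901634672,
    29083870320, 10520461936, 1666473886832, 2519628088432, 586265756528, 1668905271664,
    2519627992176, 2519636377968, 669682080940308, 1144388742817044, 3359082466400956877312]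
    2340 1617 138 [(2080, 1, 1), (2180, 1, 1), (1153, 0, 0), (1664, 0, 0)] [862584095344,
    561936924784, 12181382512, 321418758512] [],
.crit [14, 12801, 9249, 1553, 200, 68, 1072, 2320, 9856, 2314, 332, 4736, 2050, 262]
    [1126640762993, 1128511684721, 2260546208881, 2020095043953, 1683747571569, 352810027121,
    1958776188529, 1739035846769, 2543745354353, 2503011517553, 1962265625457, 903404686193,
    3461986428451317250] [(0, 14, [])] 13 1 [2, 3, 9, 10, 8, 5, 6, 4, 7, 11, 12],
.crit [138, 1045, 106, 261, 546, 276, 1156, 2113, 40, 5136, 2626, 5248, 2560] [1710480007282,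
    62629979762, 1668898989426, 10781828210, 1736542626162, 26887168626, 2759543595122,
    1926670910322, 11888075890, 3393611474802, 2019182357106, 2560624535154, 1669501881714,
    1925507031410, 61583494002, 1979200086642, 363035724658, 3085959536754, 827671552370,
    3113079554418, 1669777654642, 1926595415410, 3084869542002, 1979216847474, 825819449202,
    2760701141106, 3498006687007122179, 126425428793229137224704] [(3, 256, []), (1, 1024, []),
    (0, 128, []), (2, 64, []), (5, 256, []), (4, 512, [])] 11 7 [10, 6, 9, 12, 8],
.crit [2052, 3204, 275, 1168, 44, 784, 2176, 74, 1060, 32, 266, 67] [1935957623411,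
    294516524147, 1125382408051, 1408851854195, 293769880691, 560863168371, 2517740652659,
    912244910195, 3033657084531, 861948677235, 83046131584248837, 1835840907417026053120] [(0,
    0, [2])] 1 1 [],
.crit [12, 540, 67, 35, 450, 200, 52, 1072, 1552, 258, 384] [309331314548, 1961534177652,
    2809203877236, 1435066524788, 836228678772, 2543209768052, 836245439604, 603805476212,
    1187750406301208, 301773114143, 75616065015781820672, 76399163637139022595] [(0, 0, [2])] 1
    1 [],
.crit [4, 324, 43, 276, 200, 196, 50, 560, 10, 128] [1127967105653, 326502245493, 2207698167413,
    844289885557, 1686127575925, 1693089606261, 1968195521100, 2059670945031193,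
    2596133098144679942, 2596951392778471424] [(0, 0, [2])] 1 1 [],
.crit [8, 264, 200, 39, 224, 280, 276, 532, 98, 128] [1944010892150, 303124005494, 343681828470,
    1145146188662, 578026538358, 1959873006135, 81409525111130624, 1942442502733,
    54720610469921, 81417788644452872, 71513102141985] [(0, 0, [2])] 1 1 [],
.crit [262, 25, 97, 98, 162, 28, 268, 16, 65] [551669277047, 276833813111, 835178791031,
    1960140939639, 1393524277367, 1400428349752, 1108119677240, 602109184312, 1109461305678,
    27498813367842, 1400697792846, 1142730541390, 1206492846358811, 54169209694498,
    1443180197192475, 65338246821366017, 64775272171636992, 36919136835618841,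
    65356371599591689] [(1, 24, []), (2, 96, []), (0, 256, [])] 8 6 [3, 5, 4, 7]]

def certs12 : List Cert := [
.crit [48, 112, 152, 100, 7, 11, 138, 68] [8832625976867, 35744866919732, 876475902009,
    2042385807475200, 71796561560604, 1751799073883168] [(0, 0, [2])] 1 1 [],
.crit [4, 4, 43, 148, 72, 196, 304, 296, 192] [2475554513529, 1683914302329, 1127697654393,
    1151338358137, 2259439133561, 1967934458192] [(0, 0, [2])] 1 1 [],
.crit [1074, 261, 74, 52, 2569, 2121, 164, 2624, 1026, 1168, 769, 176] [294508659578,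
    1976784224890, 1667523248506, 276850115706, 561343201402, 45424936570, 603982759290,
    870083559546, 2208713769594, 1695472238714, 1711629502842, 1376906707322, 577497039994,
    843793367418, 860705079418, 577497009274, 45424905338, 1975954277754, 278125962618,
    1375029242490, 860665514362, 1692226055227, 1400704633915] [(5, 2112, [1152]), (3, 0, [576,
    2816]), (4, 2048, [1152]), (2, 64, [384]), (0, 1024, []), (1, 256, [])] 7 9 [6, 10, 8, 11],
.crit [50, 133, 74, 52, 1289, 1097, 548, 2, 528, 1344, 560] [560528187515, 2526540030587,
    1101140943227, 45173270139, 277378589819, 277857518971, 1934388977787, 1376629875067,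
    1933835854459, 844321841531, 578025514107, 294240215931, 578008705915, 1694398505083,
    603269433723, 28057679471654, 36560389303078, 1400704633660, 1666717084476,
    1733406120545025, 95478363283245244416] [(3, 32, [320, 1280]), (4, 256, [544]), (2, 64,
    [640]), (0, 32, [1408]), (1, 128, [])] 5 6 [7, 8, 9, 10],
.scheme [56, 28, 98, 579, 643, 5, 268, 272, 704, 280] [2251646386812, 27716568700, 594618957948,
    560568812412, 561088898172, 1377083925372, 1376612861052, 1377150968700, 1676951240828,
    1393482875260, 560568812668, 561105659004, 833266666067, 833802504765, 1675616324179,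
    1675079723581, 10465226023975, 1134723130264066, 35512156965379, 1715797828364802,
    53636902685187, 36010634521127, 2668190941290471424] 112 268 643 [(256, 2, 2), (288, 2, 2),
    (260, 2, 2), (264, 2, 2), (280, 2, 2), (129, 1, 1), (194, 1, 1), (672, 1, 1), (641, 0, 0),
    (642, 1, 1), (706, 1, 1)] [604334516348, 1394606899580, 595742982268, 45987930748,
    593588218492] [],
.crit [12, 44, 147, 67, 100, 402, 24, 36, 32] [1686043419261, 878363354237, 835699410301,
    2543435441533, 44256971483396, 8824313890088, 1144877754174, 65654091217118208] [(0, 0,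
    [2])] 1 1 [],
.crit [22, 545, 385, 208, 777, 1090, 296, 12, 1108, 1042, 800] [860344639614, 551410819454,
    611279004542, 887514817150, 612336493438, 552516543614, 878673750142, 35754173310,
    1952870114430, 1944329472126, 54977494797061, 1152997944069, 34957454165, 1760079493737220,
    70388903872041, 1169096723285, 1168827534143, 380156709471744, 35804753210116,
    1506108414951424] [(1, 544, [1028]), (0, 20, [])] 8 10 [9, 4, 2, 5, 6, 3, 7],
.crit [22, 577, 289, 48, 777, 140, 1154, 352, 1172, 1042, 832] [1393189544063, 1976224276863,
    1126951380351, 2818345886335, 551727998079, 1995818476671, 1976222690175, 550655041919,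
    3051375297663, 2560699943039, 862005577855, 1993965062976, 379057751475969, 18761266285317,
    2217302076246, 2042085989427973, 63772497840902, 2235304790826] [(1, 576, [1028]), (0, 20,
    [])] 10 8 [4, 9, 2, 6, 7, 5, 3],
.crit [38, 585, 137, 22, 104, 17, 274, 260, 704, 258] [1144357470336, 2260251787904,
    2483867435904, 550882328960, 2251126293632, 10537223808, 45148357760, 1144886214784,
    2484388053888, 1659754594432, 1410645443456, 300690213463, 1657900395073, 301763414593,
    1658973850199, 28074591920683, 1698772577479174, 53069984303623, 2059677370443266,
    17868709456427, 2341187747586562, 2684481862873440768, 2684472552180474369] [(2, 128, []),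
    (1, 576, []), (3, 16, []), (0, 32, [])] 8 6 [4, 5, 9, 7],
.crit [74, 149, 42, 1029, 770, 196, 289, 546, 80, 144, 8] [1427012149377, 560025920641,
    1967902516865, 2535641932161, 1693300122241, 1651776242561, 2251386873217, 593846429313,
    1435325522305, 1694926987905, 11367950209, 1720763884673, 3085397688705, 2534081652097,
    2534854452609, 1392735503233, 825775974017, 1935446466689, 1393809245057, 54318089601,
    593854811009, 37118499973164, 1932786944834, 1980514110884615] [(3, 1024, []), (4, 768, []),
    (1, 128, []), (2, 32, []), (0, 64, [])] 6 5 [7, 8, 9, 10]]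

def certs13 : List Cert := [
.crit [134, 49, 73, 1044, 586, 322, 52, 769, 160, 1168, 520] [552206688642, 1383803478146,
    1925538734722, 1110308380802, 1683688614274, 311478010754, 277639948162, 11368711554,
    19370436226, 1993452381570, 1178230417282, 277589090946, 11351935874, 11570300034,
    311444458370] [(0, 128, []), (1, 48, []), (3, 1040, []), (2, 64, [])] 9 10 [4, 6, 5, 7, 8],
.crit [14, 2305, 2625, 785, 1096, 1152, 20, 2848, 138, 1164, 560, 134] [1667890946179,
    1126682691715, 602722370691, 1126724804739, 1686850831235, 1126682954115, 645118920579,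
    2019441593475, 90436468231178, 36920420302915] [(0, 14, [])] 11 1 [2, 3, 8, 9, 7, 4, 6, 10,
    5],
.crit [98, 1045, 554, 84, 138, 261, 9, 1040, 544, 1284, 642] [878867472516, 53973443460,
    44051030660, 1375231107460, 843778713988, 843784979844, 10830537860, 2276342983300,
    2243056722052, 53452825476, 878363107460, 3068244796036, 2276341932676, 1393483670404,
    1651239355780, 2492993724804, 1677278848132, 1652254392708, 1677262072708, 277361781636,
    1651230968708, 35503827847947, 44566199692043, 1692503204932, 102919154317271032832,
    102621644055203874048] [(5, 256, []), (0, 64, []), (1, 1024, []), (2, 512, []), (3, 64, []),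
    (4, 128, [])] 9 10 [7, 8, 6],
.crit [38, 4241, 73, 2100, 266, 1161, 2052, 546, 6160, 5248, 2592, 1352, 770] [2792811503749,
    577415259269, 1747054865029, 2843286283141, 861468205445, 11612302469, 2302750312837,
    869303396229, 2560069838213, 2233921806725, 1403449355141, 2843915421829, 1127782813061,
    11351993477, 46249388677, 1109730369669, 2793356501125, 312745485189, 862485053829,
    578319352965, 17653432069388, 62965294591244, 9955777028677] [(1, 128, [768]), (0, 32,
    [5184]), (4, 256, []), (2, 64, []), (3, 2080, [])] 11 6 [8, 10, 5, 7, 9, 12],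
.crit [6, 2121, 177, 530, 332, 1092, 50, 1284, 656, 2312, 160, 514] [3299375112838,
    2542940030086, 1683730262150, 2236109653638, 586900906886, 3299928269190, 328934704518,
    2809010399366, 1128007822470, 1128024599686, 1694423346310, 1694423411846, 45655536446477,
    27530790980621, 8823507617094, 3313580875904527377920] [(0, 6, [])] 11 1 [2, 5, 6, 4, 3, 9,
    8, 7, 10],
.crit [138, 37, 194, 273, 1032, 258, 516, 773, 1192, 1216, 784] [1385454985351, 2243600408967,
    61288835463, 1444812948359, 2260319126151, 28271011975, 2535129964679, 3042246207367,
    276566206343, 1384080302215, 276582925191, 3067203111047, 827394189191, 1384147370631,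
    827411677575, 1667254018439, 320807454855, 2243139469703, 1186847312263, 1444796263047,
    28270939015, 26406861941518, 19543443704590, 10187723334471, 102666678368926180608] [(2,
    192, []), (0, 128, [528]), (1, 32, []), (3, 272, [])] 9 10 [7, 8, 4, 5, 6],
.crit [260, 772, 43, 580, 544, 84, 168, 64, 3, 26] [1145145942664, 293988287880, 2209250101640,
    1178751026056, 2499756222088, 1410898619016, 1144610646664, 576902998623,
    2092494949832213766, 2307902171701879813, 2883730963899425536, 2884618243736627459] [(0, 0,
    [2])] 1 1 [],
.crit [24, 56, 112, 67, 135, 262, 12, 16, 32] [2475528873097, 878363878025, 835178792329,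
    878087316105, 44256987736336, 8824297129268, 28037849097545, 29626634488252160,
    65654090672407048] [(0, 0, [2])] 1 1 [],
.crit [42, 21, 162, 273, 586, 69, 48, 260, 648, 272] [1110309159562, 1942969467274,
    1694390108298, 1994208134026, 2800864797834, 561056916618, 1943774773642, 26392208522,
    26367044234, 1152947144074, 1428622746762, 827135116682, 27466721418, 610692311690,
    559738292833, 559471135307, 2341436897100300, 276002810465, 276271491659, 845534684834320,
    2341436092580352, 573122080999952, 17894445713937, 26698097101365, 2059952249381632,
    2059953590248204] [(2, 160, []), (1, 16, []), (0, 32, []), (3, 272, [])] 8 7 [5, 4, 6, 9],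
.crit [546, 1045, 74, 52, 138, 2121, 292, 1040, 2112, 3073, 642, 800] [1693301702795,
    44862899083, 10788635275, 2475529699723, 10838926475, 870345444235, 561375971979,
    44931499659, 2010866876811, 278125962635, 1377646952843, 1377628668299, 2475001742731,
    869831876747, 560326844555, 861233302667, 277076608395, 11644232843, 603258449035,
    3068519875467, 2294418590091, 45198885771, 276858455435, 2759567704715, 2010682321291,
    2357405284582401, 1125550435426, 53360700173330, 36060562500626, 2331840859177217,
    2075912892081665, 843157351522] [(0, 544, []), (4, 128, []), (1, 0, [640]), (3, 32, []), (2,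
    64, [])] 10 9 [7, 6, 5, 11, 8]]

def certs14 : List Cert := [
.crit [12, 140, 83, 3, 36, 912, 388, 98, 1120, 1056, 768] [1411703644812, 3058346042764,
    335100839308, 2517666195340, 1119444887180, 1718793350028, 2251369294732, 2827758865292,
    942291708078082, 10790082489107, 83112270903842980864] [(0, 0, [2])] 1 1 [],
.crit [38, 73, 137, 22, 40, 593, 290, 4, 576, 288] [1410645443469, 1127479329165, 1943783424141,
    1144424564365, 2783677326733, 1127512859277, 277102019981, 861679461773, 1942441246861,
    1126975988365, 835187967629, 1660358247309, 1127244415373, 1410981176205, 1376621748877,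
    1942945350541, 276841964941, 861753361805, 861216500365, 1941645109901, 2252526584205,
    1942945344141, 860671240845, 550594980452, 53069690989076, 9967266404, 1699021442312723,
    2340911821627907, 551132342862, 27505240393293, 2059402769860099, 9430157902,
    2108256398567852288] [(2, 128, []), (1, 64, []), (0, 32, []), (3, 16, [])] 5 4 [6, 7, 8, 9],
.crit [40, 44, 274, 19, 204, 67, 48, 272, 132] [292134904974, 1683703005838, 1428404585614,
    17868700821781, 45630027276878, 65381945202189056, 65383052741730563] [(0, 0, [2])] 1 1 [],
.crit [24, 216, 40, 7, 35, 84, 290, 258, 192] [844012529039, 592781313679, 578001355151,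
    53052007803158, 2595397508564485, 26938338256463, 8824321246778] [(0, 0, [2])] 1 1 [],
.crit [70, 41, 25, 134, 36, 82, 33, 8] [1410653553296, 1144365580688, 1118639235216,
    1651172770448, 1118369538960, 1650643454055, 9161189479, 1649839188049, 18295842897,
    10490475447099, 1692234188903, 26407112550459, 52803411396631, 45131785372496,
    2041818905060870, 1690233931098134, 2041819441407506, 2041836580120065, 2041535437743616]
    [(3, 128, []), (1, 32, [192]), (2, 16, []), (0, 64, [])] 5 4 [6, 7],
.crit [12, 28, 67, 35, 34, 88, 36] [62716723618048, 35460887103256, 8815195481148,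
    19251923559245, 19241748456529] [(0, 0, [2])] 1 1 [],
.crit [138, 21, 74, 37, 34, 24, 132, 65] [1710479966354, 1667563062162, 1977052627602,
    1925521670546, 1710764654738, 1925261624210, 1976767939218, 1667823108498, 825221245033,
    841872623721, 26072361065, 9437743209] [(2, 64, []), (0, 128, []), (3, 32, []), (1, 16, [])]
    5 4 [7, 6],
.crit [4, 4, 43, 148, 72, 196, 48, 296, 128] [1127698670227, 1151338358163, 1694633829011,
    1683914302355, 2259439658387, 2259439133587, 1967934458218, 1951308220778] [(0, 0, [2])] 1 1
    [],
.crit [2, 85, 386, 128, 162, 272, 130, 92, 36] [1411165766036, 1443973374612, 2218620141972,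
    2242837292180, 1411216074644, 2218670450580, 293175363947, 309843503467] [(0, 2, [12, 24,
    72])] 7 3 [1, 4, 6, 2, 5, 8],
.crit [14, 1281, 1089, 337, 552, 2192, 652, 352, 650, 1360, 518, 32] [1411972137877,
    1969855759509, 2508363490709, 1128335163541, 1437279815317, 601632376725, 1709498787221,
    1412039264661, 353279340465153, 617162131647489, 1463485160292608] [(0, 14, [1040])] 10 1
    [2, 3, 6, 9, 8, 4, 7, 5, 11]]

def certs15 : List Cert := [
.scheme [52, 88, 201, 1062, 3, 585, 294, 1284, 704, 1312, 648] [311134871702, 36558430614,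
    302854005398, 44912960406, 329177458070, 19663251094, 311696122006, 1943784218774,
    37070922134, 2776747827606, 2809227469462, 19680027542, 1102523974294, 302870783382,
    44896183958, 1111122028182, 1111138804630, 1102540752278, 842117155693, 575560493933,
    575827651415, 841847458647, 2578355061320450, 2305684491029250, 1989016829635330,
    312191263236, 1146525203867905, 1100090731268, 2842246166153986, 37321491204, 1102481507076,
    1155312463955969, 104366982123707754496] 1072 713 262 [(144, 2, 2), (272, 1, 1), (1040, 1,
    1), (1296, 1, 1), (1282, 1, 1), (528, 2, 2), (656, 2, 2), (641, 0, 0)] [20495550358,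
    329732925590, 312551710870, 37674074518, 303963122326, 46265354646] [],
.crit [14, 529, 673, 609, 34, 28, 264, 260, 704, 270] [1109737947287, 1109998256279,
    1942961340567, 551132342894, 550059141720, 2371760948652025088] [(0, 0, [512])] 9 9 [],
.crit [76, 76, 291, 19, 40, 84, 163, 64, 4] [1127211409560, 1127447339160, 2218133364888,
    1411190882566, 1125551196422, 2597090506596608] [(0, 0, [2])] 1 1 [],
.crit [14, 769, 449, 657, 72, 896, 20, 44, 38, 42] [1686313952153, 1153737745049, 1126708027545,
    1667874168985, 1686337226503, 1153753155335, 1128700771624196, 1416189802529536,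
    1416197872370176, 1470074443540997] [(0, 14, [])] 8 1 [2, 3, 7, 5, 9, 4, 6],
.crit [138, 21, 74, 293, 34, 24, 260, 257, 200] [1410376737178, 1144879334298, 1410628919706,
    1925773861274, 1144894063514, 1109788516506, 1401845768346, 1110056944282, 1402114196122,
    9437743473, 1411174367752, 1144902648328, 1411174383624, 1144902664200, 1128417621984773,
    1750449657553153, 1750432217637633, 1707551515273478, 27145816411, 1971434306455814,
    74592029837148672] [(0, 136, []), (1, 16, []), (2, 72, [])] 8 3 [6, 7, 4, 5],
.crit [138, 21, 74, 37, 34, 24, 4, 1] [1144088757147, 1410628911515, 1109780127899,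
    1110048555675, 1144340939675, 1925774115739, 1410376728987, 1925773853083, 1401837379739,
    1402105807515, 26072361074, 9437743218, 1410905932297, 1144634212873, 1410905948169,
    1144634228745, 1707551515273223, 1971434306455559, 27145816156, 2306544565756416,
    2306536227496448, 1128142744077830, 1750449657544962, 1750432217629442] [(2, 64, []), (0,
    128, []), (3, 32, []), (1, 16, [])] 4 5 [7, 6],
.crit [20, 84, 35, 48, 11, 12, 2] [869480268042, 1402072465674, 54744475271424, 54744475271433]
    [(0, 0, [2])] 1 1 [],
.crit [18, 5, 42, 20, 41, 20] [1658931668224, 276522624267, 10218398987] [(3, 0, [32])] 5 5 []]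

def certs : List Cert := certs0 ++ certs1 ++ certs2 ++ certs3 ++ certs4 ++ certs5 ++ certs6 ++
    certs7 ++ certs8 ++ certs9 ++ certs10 ++ certs11 ++ certs12 ++ certs13 ++ certs14 ++ certs15

set_option maxRecDepth 100000 in
theorem run_ok : run [forkG] certs = true := by decide +kernel

end ForkCert

theorem minCex_unique_common_neighbor {V : Type} [Fintype V]
    (G : SimpleGraph V) (hG : MinCex G) (c : Fin 5 → V) (hc : GoodC5 G c)
    (i j : Fin 5) (hij : c i ≠ c j) (hnadj : ¬ G.Adj (c i) (c j)) :
    {x : V | G.Adj (c i) x ∧ G.Adj (c j) x}.ncard = 1 := by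
  have hH := ForkCert.hyp_of_minCex hG
  have hr : ForkCert.Refuted G [18, 5, 42, 20, 41, 20] :=
    ForkCert.run_sound hH ForkCert.certs [ForkCert.forkG]
      (fun p hp => by rw [List.mem_singleton.1 hp]; exact ForkCert.refuted_forkG hG.2.1)
      ForkCert.run_ok
  have hcyc := hc.1.2
  have key : ∀ i j : Fin 5, i = j ∨ i + 1 = j ∨ j + 1 = i ∨ i + 2 = j ∨ j + 2 = i := by decide
  rcases key i j with h | h | h | h | h
  · exact absurd (congrArg c h) hij
  · exact absurd (h ▸ hcyc i) hnadj
  · exact absurd (h ▸ hcyc j : G.Adj (c j) (c i)).symm hnadj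
  · subst h
    rw [ForkCert.common_unique hH.tf hr hcyc i, Set.ncard_singleton]
  · subst h
    have : {x : V | G.Adj (c (j + 2)) x ∧ G.Adj (c j) x} =
        {x : V | G.Adj (c j) x ∧ G.Adj (c (j + 2)) x} := by
      ext x; exact and_comm
    rw [this, ForkCert.common_unique hH.tf hr hcyc j, Set.ncard_singleton]
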